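/- arXiv:2304.11017 — 13 statements merged into one kernel-verified Lean document; each statement's English description precedes it below -/
import Mathlib

section
/- Let T be a random variable taking values in [1,∞]. Then the infimum over α ≥ 1 of α / P(T ≤ α) equals the infimum over q ∈ (0,1] of Q_p(q)/q, i.e. inf_{α≥1} α/P(T≤α) = inf_{q∈(0,1]} Q_p(q)/q. -/
open MeasureTheory ENNReal

/-- The `q`-quantile of the distribution of `T`:
`Q_p(q) = inf {α ∈ [1,∞) : P(T ≤ α) ≥ q}`, equal to `∞` if no such `α` exists. -/
noncomputable def quantile {Ω : Type*} [MeasurableSpace Ω] (μ : Measure Ω)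
    (T : Ω → ℝ≥0∞) (q : ℝ≥0∞) : ℝ≥0∞ :=
  sInf {α : ℝ≥0∞ | 1 ≤ α ∧ α ≠ ⊤ ∧ q ≤ μ {ω | T ω ≤ α}}

/-- `inf_{α ≥ 1} α / P(T ≤ α) = inf_{q ∈ (0,1]} Q_p(q) / q`. -/
theorem stmt0 {Ω : Type*} [MeasurableSpace Ω] (μ : Measure Ω) [IsProbabilityMeasure μ]
    (T : Ω → ℝ≥0∞) (hTmeas : Measurable T) (hT1 : ∀ ω, 1 ≤ T ω) :
    (⨅ α ∈ Set.Ico (1 : ℝ≥0∞) ⊤, α / μ {ω | T ω ≤ α})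
      = ⨅ q ∈ Set.Ioc (0 : ℝ≥0∞) 1, quantile μ T q / q := by
  apply le_antisymm
  · refine le_iInf₂ fun q hq => ?_
    have hq_top : q ≠ ⊤ := ne_top_of_le_ne_top one_ne_top hq.2
    rw [ENNReal.le_div_iff_mul_le (Or.inl hq.1.ne') (Or.inl hq_top)]
    refine le_sInf fun α ⟨hα1, hα_top, hqα⟩ => ?_
    rw [← ENNReal.le_div_iff_mul_le (Or.inl hq.1.ne') (Or.inl hq_top)]
    exact (iInf₂_le α ⟨hα1, hα_top.lt_top⟩).trans (ENNReal.div_le_div_left hqα α)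
  · refine le_iInf₂ fun α hα => ?_
    rcases eq_or_ne (μ {ω | T ω ≤ α}) 0 with h0 | h0
    · rw [h0, ENNReal.div_zero (zero_lt_one.trans_le hα.1).ne']
      exact le_top
    · have h_quantile : quantile μ T (μ {ω | T ω ≤ α}) ≤ α :=
        sInf_le ⟨hα.1, hα.2.ne, le_rfl⟩
      exact (iInf₂_le (μ {ω | T ω ≤ α}) ⟨pos_iff_ne_zero.2 h0, prob_le_one⟩).trans
        (ENNReal.div_le_div_right h_quantile _)
end

section
/- Let T be a random variable taking values in [1,∞]. Then (1/2)·inf_{q∈(0,1]} Q_p(q)/q ≤ inf_{α≥1} E[min{T,α}]/P(T≤α) ≤ inf_{q∈(0,1]} Q_p(q)/q. -/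
open MeasureTheory ENNReal

/-- The infimum of `quantile μ T q / q` gives a linear bound on the distribution function. -/
theorem iInf_quantile_div_mul_measure_le {Ω : Type*} [MeasurableSpace Ω] (μ : Measure Ω)
    [IsProbabilityMeasure μ] (T : Ω → ℝ≥0∞) (hT1 : ∀ ω, 1 ≤ T ω) {t : ℝ≥0∞} (ht : t ≠ ⊤) :
    (⨅ q ∈ Set.Ioc (0 : ℝ≥0∞) 1, quantile μ T q / q) * μ {ω | T ω ≤ t} ≤ t := by
  rcases eq_or_ne (μ {ω | T ω ≤ t}) 0 with h0 | h0
  · simp [h0]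
  have ht1 : 1 ≤ t := by
    obtain ⟨ω, hω⟩ := nonempty_of_measure_ne_zero h0
    exact (hT1 ω).trans hω
  rw [← ENNReal.le_div_iff_mul_le (Or.inl h0) (Or.inl (measure_ne_top _ _))]
  refine (iInf₂_le (μ {ω | T ω ≤ t}) ⟨pos_iff_ne_zero.2 h0, prob_le_one⟩).trans ?_
  gcongr
  exact sInf_le ⟨ht1, ht, le_rfl⟩

/-- If `P(T ≤ t) ≤ t / m` for all finite `t`, then `E[min {T, m F}] ≥ m F / 2` for `F ∈ [0,1]`. -/
theorem half_mul_le_lintegral_min {Ω : Type*} [MeasurableSpace Ω] (μ : Measure Ω)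
    [IsProbabilityMeasure μ] (T : Ω → ℝ≥0∞) (hTmeas : Measurable T) {m F : ℝ} (hm : 0 < m)
    (hF0 : 0 ≤ F) (hF1 : F ≤ 1)
    (h : ∀ t : ℝ≥0∞, t ≠ ⊤ → ENNReal.ofReal m * μ {ω | T ω ≤ t} ≤ t) :
    ENNReal.ofReal (m * F / 2) ≤ ∫⁻ ω, min (T ω) (ENNReal.ofReal (m * F)) ∂μ := by
  have hc : 0 ≤ m * F := by positivity
  have hmin : ∀ ω, min (T ω) (ENNReal.ofReal (m * F)) ≠ ⊤ := fun ω =>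
    ne_top_of_le_ne_top ENNReal.ofReal_ne_top (min_le_right _ _)
  have hlayer : ∫⁻ ω, min (T ω) (ENNReal.ofReal (m * F)) ∂μ
      = ∫⁻ t in Set.Ioi (0 : ℝ),
          μ {ω | t < (min (T ω) (ENNReal.ofReal (m * F))).toReal} := by
    rw [← lintegral_eq_lintegral_meas_lt μ (Filter.Eventually.of_forall fun ω =>
      ENNReal.toReal_nonneg) (hTmeas.min measurable_const).ennreal_toReal.aemeasurable]
    exact lintegral_congr fun ω => (ENNReal.ofReal_toReal (hmin ω)).symm
  have htail : ∀ t ∈ Set.Ioo (0 : ℝ) (m * F), ENNReal.ofReal (1 - t / m)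
      ≤ μ {ω | t < (min (T ω) (ENNReal.ofReal (m * F))).toReal} := by
    rintro t ⟨ht0, htc⟩
    have hset : {ω | t < (min (T ω) (ENNReal.ofReal (m * F))).toReal}
        = {ω | T ω ≤ ENNReal.ofReal t}ᶜ := by
      ext ω
      simp only [Set.mem_ofPred_eq, Set.mem_compl_iff, not_le]
      rw [← ENNReal.ofReal_lt_iff_lt_toReal ht0.le (hmin ω), lt_min_iff]
      exact and_iff_left ((ENNReal.ofReal_lt_ofReal_iff (ht0.trans htc)).2 htc)
    rw [hset, prob_compl_eq_one_sub (measurableSet_le hTmeas measurable_const),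
      ENNReal.ofReal_sub _ (by positivity), ENNReal.ofReal_one, ENNReal.ofReal_div_of_pos hm]
    gcongr
    rw [ENNReal.le_div_iff_mul_le (Or.inl (by simpa using hm)) (Or.inl ENNReal.ofReal_ne_top),
      mul_comm]
    exact h _ ENNReal.ofReal_ne_top
  have hint : ∫ t in Set.Ioo (0 : ℝ) (m * F), (1 - t / m) = m * F - m * F ^ 2 / 2 := by
    rw [← integral_Ioc_eq_integral_Ioo, ← intervalIntegral.integral_of_le hc,
      intervalIntegral.integral_sub (by simp) (Continuous.intervalIntegrable (by fun_prop) _ _),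
      intervalIntegral.integral_div, integral_id, intervalIntegral.integral_const]
    simp only [smul_eq_mul]
    field_simp
    ring
  calc ENNReal.ofReal (m * F / 2)
      ≤ ENNReal.ofReal (∫ t in Set.Ioo (0 : ℝ) (m * F), (1 - t / m)) := by
        rw [hint]
        apply ENNReal.ofReal_le_ofReal
        nlinarith [mul_nonneg hc (sub_nonneg.2 hF1)]
    _ = ∫⁻ t in Set.Ioo (0 : ℝ) (m * F), ENNReal.ofReal (1 - t / m) := by
        refine ofReal_integral_eq_lintegral_ofReal ?_ ?_
        · exact (Continuous.integrableOn_Icc (by fun_prop)).mono_set Set.Ioo_subset_Icc_self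
        · filter_upwards [ae_restrict_mem measurableSet_Ioo] with t ht
          have : t / m ≤ 1 := (div_le_one hm).2 (ht.2.le.trans (by nlinarith))
          simpa using this
    _ ≤ ∫⁻ t in Set.Ioo (0 : ℝ) (m * F),
          μ {ω | t < (min (T ω) (ENNReal.ofReal (m * F))).toReal} :=
        setLIntegral_mono' measurableSet_Ioo htail
    _ ≤ ∫⁻ t in Set.Ioi (0 : ℝ),
          μ {ω | t < (min (T ω) (ENNReal.ofReal (m * F))).toReal} :=
        lintegral_mono_set Set.Ioo_subset_Ioi_self
    _ = _ := hlayer.symm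

/-- `(1/2) · inf_{q ∈ (0,1]} Q_p(q)/q ≤ inf_{α ≥ 1} E[min{T,α}] / P(T ≤ α)
      ≤ inf_{q ∈ (0,1]} Q_p(q)/q`. -/
theorem stmt1 {Ω : Type*} [MeasurableSpace Ω] (μ : Measure Ω) [IsProbabilityMeasure μ]
    (T : Ω → ℝ≥0∞) (hTmeas : Measurable T) (hT1 : ∀ ω, 1 ≤ T ω) :
    (1 / 2) * (⨅ q ∈ Set.Ioc (0 : ℝ≥0∞) 1, quantile μ T q / q)
        ≤ (⨅ α ∈ Set.Ico (1 : ℝ≥0∞) ⊤, (∫⁻ ω, min (T ω) α ∂μ) / μ {ω | T ω ≤ α})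
      ∧ (⨅ α ∈ Set.Ico (1 : ℝ≥0∞) ⊤, (∫⁻ ω, min (T ω) α ∂μ) / μ {ω | T ω ≤ α})
        ≤ ⨅ q ∈ Set.Ioc (0 : ℝ≥0∞) 1, quantile μ T q / q := by
  constructor
  · have hbound := fun t ht => iInf_quantile_div_mul_measure_le μ T hT1 (t := t) ht
    set m := ⨅ q ∈ Set.Ioc (0 : ℝ≥0∞) 1, quantile μ T q / q
    refine le_iInf₂ fun α hα => ?_
    rcases eq_or_ne (μ {ω | T ω ≤ α}) 0 with hF | hF
    · have hpos : (∫⁻ ω, min (T ω) α ∂μ) ≠ 0 := by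
        refine (zero_lt_one.trans_le ?_).ne'
        calc (1 : ℝ≥0∞) = ∫⁻ _, 1 ∂μ := by simp
          _ ≤ _ := lintegral_mono fun ω => le_min (hT1 ω) hα.1
      simp [hF, ENNReal.div_zero hpos]
    rcases eq_or_ne m 0 with hm0 | hm0
    · simp [hm0]
    have hFtop : μ {ω | T ω ≤ α} ≠ ⊤ := measure_ne_top _ _
    have hmtop : m ≠ ⊤ := by
      intro hm
      have := hbound α hα.2.ne
      rw [hm, ENNReal.top_mul hF] at this
      exact hα.2.ne (top_le_iff.1 this)
    rw [ENNReal.le_div_iff_mul_le (Or.inl hF) (Or.inl hFtop)]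
    have hmF : ENNReal.ofReal (m.toReal * (μ {ω | T ω ≤ α}).toReal) = m * μ {ω | T ω ≤ α} := by
      rw [ENNReal.ofReal_mul ENNReal.toReal_nonneg, ENNReal.ofReal_toReal hmtop,
        ENNReal.ofReal_toReal hFtop]
    have key := half_mul_le_lintegral_min μ T hTmeas (ENNReal.toReal_pos hm0 hmtop)
      (F := (μ {ω | T ω ≤ α}).toReal) ENNReal.toReal_nonneg
      (ENNReal.toReal_le_of_le_ofReal zero_le_one (by simpa using prob_le_one))
      (by simpa only [ENNReal.ofReal_toReal hmtop] using hbound)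
    rw [ENNReal.ofReal_div_of_pos two_pos, hmF, ENNReal.ofReal_ofNat] at key
    calc 1 / 2 * m * μ {ω | T ω ≤ α} = m * μ {ω | T ω ≤ α} / 2 := by
          rw [one_div, mul_assoc, mul_comm, div_eq_mul_inv]
      _ ≤ _ := key
      _ ≤ _ := lintegral_mono fun ω => min_le_min le_rfl (hbound α hα.2.ne)
  · refine le_iInf₂ fun q hq => ?_
    have hq0 : q ≠ 0 := hq.1.ne'
    have hqtop : q ≠ ⊤ := ne_top_of_le_ne_top ENNReal.one_ne_top hq.2
    rw [ENNReal.le_div_iff_mul_le (Or.inl hq0) (Or.inl hqtop)]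
    refine le_sInf fun α ⟨hα1, hαtop, hqα⟩ => ?_
    rw [← ENNReal.le_div_iff_mul_le (Or.inl hq0) (Or.inl hqtop)]
    refine (iInf₂_le α ⟨hα1, hαtop.lt_top⟩).trans (ENNReal.div_le_div ?_ hqα)
    calc (∫⁻ ω, min (T ω) α ∂μ) ≤ ∫⁻ _, α ∂μ := lintegral_mono fun ω => min_le_right _ _
      _ = α := by simp
end

section
/- Let T be a random variable taking values in [1,∞], let q ∈ (0,1] and γ > 1 satisfy (1−q)·γ < 1, and suppose Q_p(q) < ∞. With K_q = ⌈log_γ Q_p(q)⌉, the geometric cutoff series satisfies ∑_{k=0}^{∞} (∏_{l=0}^{k-1} P(T > γ^l)) · γ^k ≤ γ^{K_q}/(γ−1) + γ^{K_q}/(1−(1−q)γ). -/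
open MeasureTheory ENNReal

/-- The infimum defining the quantile is attained: by right-continuity of the distribution function,
`P(T ≤ a) ≥ q` for every finite `a ≥ Q_p(q)`. -/
theorem le_measure_of_quantile_le {Ω : Type*} [MeasurableSpace Ω] {μ : Measure Ω}
    [IsFiniteMeasure μ] {T : Ω → ℝ≥0∞} (hT : Measurable T) {q a : ℝ≥0∞} (ha : a ≠ ⊤)
    (h : quantile μ T q ≤ a) : q ≤ μ {ω | T ω ≤ a} := by
  have hlim : Filter.Tendsto (fun b => μ {ω | T ω ≤ b}) (nhdsWithin a (Set.Ioi a))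
      (nhds (μ (⋂ b > a, {ω | T ω ≤ b}))) :=
    tendsto_measure_biInter_gt (s := fun b => {ω | T ω ≤ b})
      (fun b _ => (measurableSet_le hT measurable_const).nullMeasurableSet)
      (fun i j _ hij ω hω => le_trans hω hij)
      ⟨⊤, ha.lt_top, measure_ne_top _ _⟩
  have hset : (⋂ b > a, {ω | T ω ≤ b}) = {ω | T ω ≤ a} := by
    ext ω
    simp only [Set.mem_iInter, Set.mem_ofPred_eq]
    exact ⟨fun H => le_of_forall_gt_imp_ge_of_dense H, fun H b hb => H.trans hb.le⟩
  rw [hset] at hlim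
  have : (nhdsWithin a (Set.Ioi a)).NeBot := nhdsGT_neBot_of_exists_gt ⟨⊤, ha.lt_top⟩
  refine ge_of_tendsto hlim ?_
  filter_upwards [self_mem_nhdsWithin] with b hb
  obtain ⟨α, ⟨-, -, hα⟩, hαb⟩ := sInf_lt_iff.1 (h.trans_lt hb)
  exact hα.trans (measure_mono fun ω (hω : T ω ≤ α) => hω.trans hαb.le)

/-- Above the quantile, the tail probability is at most `1 - q`. -/
theorem measure_lt_le_of_quantile_le {Ω : Type*} [MeasurableSpace Ω] {μ : Measure Ω}
    [IsProbabilityMeasure μ] {T : Ω → ℝ≥0∞} (hT : Measurable T) {q a : ℝ≥0∞} (ha : a ≠ ⊤)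
    (h : quantile μ T q ≤ a) : μ {ω | a < T ω} ≤ 1 - q := by
  have hcompl : {ω | a < T ω} = {ω | T ω ≤ a}ᶜ := by ext ω; simp
  rw [hcompl, prob_compl_eq_one_sub (measurableSet_le hT measurable_const)]
  exact tsub_le_tsub_left (le_measure_of_quantile_le hT ha h) 1

/-- If `x ≤ 1` termwise and `x l ≤ r` from index `K` on, the geometric cutoff series is bounded by
its first `K` terms plus a geometric tail. -/
theorem tsum_prod_mul_pow_le {x : ℕ → ℝ≥0∞} {K : ℕ} {r γ : ℝ} (hr : 0 ≤ r) (hγ : 1 < γ)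
    (hrγ : r * γ < 1) (hx : ∀ l, x l ≤ 1) (hxK : ∀ l, K ≤ l → x l ≤ ENNReal.ofReal r) :
    ∑' k : ℕ, (∏ l ∈ Finset.range k, x l) * ENNReal.ofReal (γ ^ k)
      ≤ ENNReal.ofReal (γ ^ K / (γ - 1) + γ ^ K / (1 - r * γ)) := by
  have hγ0 : 0 < γ := by linarith
  have hγ1 : 0 < γ - 1 := by linarith
  have hrγ0 : 0 ≤ r * γ := by positivity
  have hrγ1 : 0 < 1 - r * γ := by linarith
  rw [ENNReal.ofReal_add (by positivity) (by positivity),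
    ← Summable.sum_add_tsum_nat_add' (k := K) ENNReal.summable]
  refine add_le_add ?_ ?_
  · calc ∑ k ∈ Finset.range K, (∏ l ∈ Finset.range k, x l) * ENNReal.ofReal (γ ^ k)
        ≤ ∑ k ∈ Finset.range K, ENNReal.ofReal (γ ^ k) :=
          Finset.sum_le_sum fun k _ =>
            mul_le_of_le_one_left' (Finset.prod_le_one' fun l _ => hx l)
      _ = ENNReal.ofReal ((γ ^ K - 1) / (γ - 1)) := by
          rw [← geom_sum_eq hγ.ne', ENNReal.ofReal_sum_of_nonneg fun k _ => by positivity]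
      _ ≤ ENNReal.ofReal (γ ^ K / (γ - 1)) := by
          gcongr
          linarith
  · have hsum : HasSum (fun j : ℕ => γ ^ K * (r * γ) ^ j) (γ ^ K / (1 - r * γ)) := by
      rw [div_eq_mul_inv]
      exact (hasSum_geometric_of_lt_one hrγ0 hrγ).mul_left _
    rw [← hsum.tsum_eq, ENNReal.ofReal_tsum_of_nonneg (fun j => by positivity) hsum.summable]
    refine ENNReal.tsum_le_tsum fun j => ?_
    have hprod : ∏ l ∈ Finset.range (j + K), x l ≤ ENNReal.ofReal r ^ j := by
      rw [add_comm, Finset.prod_range_add, ← one_mul (ENNReal.ofReal r ^ j)]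
      refine mul_le_mul' (Finset.prod_le_one' fun l _ => hx l) ?_
      simpa using Finset.prod_le_pow_card (Finset.range j) (fun l => x (K + l)) _
        fun l _ => hxK _ (Nat.le_add_right K l)
    refine (mul_le_mul_left hprod _).trans_eq ?_
    rw [← ENNReal.ofReal_pow hr, ← ENNReal.ofReal_mul (by positivity)]
    congr 1
    ring

/-- For `q ∈ (0,1]`, `γ > 1` with `(1-q)γ < 1` and `Q_p(q) < ∞`, setting
`K_q = ⌈log_γ Q_p(q)⌉`, the geometric cutoff series satisfies
`∑_{k=0}^∞ (∏_{l=0}^{k-1} P(T > γ^l)) γ^k ≤ γ^{K_q}/(γ-1) + γ^{K_q}/(1-(1-q)γ)`. -/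
theorem stmt4 {Ω : Type*} [MeasurableSpace Ω] (μ : Measure Ω) [IsProbabilityMeasure μ]
    (T : Ω → ℝ≥0∞) (hTmeas : Measurable T) (hT1 : ∀ ω, 1 ≤ T ω)
    (q γ : ℝ) (hq0 : 0 < q) (hq1 : q ≤ 1) (hγ : 1 < γ) (hqγ : (1 - q) * γ < 1)
    (hQ : quantile μ T (ENNReal.ofReal q) ≠ ⊤) :
    ∑' k : ℕ, (∏ l ∈ Finset.range k, μ {ω | ENNReal.ofReal (γ ^ l) < T ω})
        * ENNReal.ofReal (γ ^ k)
      ≤ ENNReal.ofReal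
          (γ ^ ⌈Real.logb γ ((quantile μ T (ENNReal.ofReal q)).toReal)⌉₊ / (γ - 1)
            + γ ^ ⌈Real.logb γ ((quantile μ T (ENNReal.ofReal q)).toReal)⌉₊
                / (1 - (1 - q) * γ)) := by
  set Q := quantile μ T (ENNReal.ofReal q)
  have hQ1 : 1 ≤ Q := le_sInf fun α hα => hα.1
  have hQpos : 0 < Q.toReal := ENNReal.toReal_pos (zero_lt_one.trans_le hQ1).ne' hQ
  refine tsum_prod_mul_pow_le (by linarith) hγ hqγ (fun l => prob_le_one) fun l hl => ?_
  rw [ENNReal.ofReal_sub 1 hq0.le, ENNReal.ofReal_one]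
  refine measure_lt_le_of_quantile_le hTmeas ENNReal.ofReal_ne_top ?_
  rw [ENNReal.le_ofReal_iff_toReal_le hQ (by positivity), ← Real.rpow_natCast,
    ← Real.logb_le_iff_le_rpow hγ hQpos]
  exact Nat.ceil_le.1 hl
end

section
/- Let φ : (0,1] → (0,∞) be strictly increasing and continuous with inf φ = 0, let Φ : [1,∞) → [0,∞) be strictly increasing and continuous, and define c_{Φ,φ}(r) for r ≥ 1/φ(1) as c_{Φ,φ}(r) = (1/r)·Φ^{−1}( Φ(r·φ(1)) − ∫_{Φ(1)}^{Φ(rφ(1))} φ^{−1}( Φ^{−1}(u)/r ) du ). If a constant C' > 0 is such that for every random variable T with values in [1,∞] one has inf_{q∈(0,1]} Q_p(q)/φ(q) ≤ C' · Φ^{−1}(E[Φ(T)]), then C' ≥ 1 / inf_{r ≥ 1/φ(1)} c_{Φ,φ}(r); in particular, if inf_{r ≥ 1/φ(1)} c_{Φ,φ}(r) = 0, no finite constant C' can satisfy this inequality for all T. -/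
open MeasureTheory ENNReal Filter

/-- The `q`-quantile of a distribution `p` on `[1,∞]`:
`Q_p(q) = inf {α ∈ [1,∞) : p((-∞,α]) ≥ q}`, equal to `∞` if no such `α` exists. -/
noncomputable def quantileD (p : Measure ℝ≥0∞) (q : ℝ≥0∞) : ℝ≥0∞ :=
  sInf {α : ℝ≥0∞ | 1 ≤ α ∧ α ≠ ⊤ ∧ q ≤ p (Set.Iic α)}

/-- The inverse of `φ : (0,1] → (0,∞)`, defined on `(0, φ(1)]` (it takes the junk
value `∞` outside the range of `φ`). -/
noncomputable def lowInv (φ : ℝ≥0∞ → ℝ≥0∞) (y : ℝ≥0∞) : ℝ≥0∞ :=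
  sInf {x : ℝ≥0∞ | x ∈ Set.Ioc 0 1 ∧ y ≤ φ x}

/-- The inverse of `Φ : [1,∞) → [0,∞)`, extended by `Φ⁻¹(y) = ∞` for `y ≥ sup Φ`. -/
noncomputable def upInv (Φ : ℝ≥0∞ → ℝ≥0∞) (y : ℝ≥0∞) : ℝ≥0∞ :=
  sInf {t : ℝ≥0∞ | 1 ≤ t ∧ y ≤ Φ t}

/-- `c_{Φ,φ}(r) = (1/r) Φ⁻¹( Φ(rφ(1)) - ∫_{Φ(1)}^{Φ(rφ(1))} φ⁻¹(Φ⁻¹(u)/r) du )`. -/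
noncomputable def cFun (φ Φ : ℝ≥0∞ → ℝ≥0∞) (r : ℝ≥0∞) : ℝ≥0∞ :=
  upInv Φ (Φ (r * φ 1)
      - ∫⁻ u in Set.Ioc (Φ 1).toReal (Φ (r * φ 1)).toReal,
          lowInv φ (upInv Φ (ENNReal.ofReal u) / r)) / r

/-- The random variable `max(1, rφ(U))` on `ℝ`, where `U` is clipped to `(-∞, 1]` and the value is
`1` for `U ≤ 0`. -/
noncomputable def extremalVar (φ : ℝ≥0∞ → ℝ≥0∞) (r : ℝ≥0∞) (w : ℝ) : ℝ≥0∞ :=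
  if w ≤ 0 then 1 else max 1 (r * φ (ENNReal.ofReal (min w 1)))

/-- The law of `max(1, rφ(U))` for `U` uniform on `(0,1]`. -/
noncomputable def extremalLaw (φ : ℝ≥0∞ → ℝ≥0∞) (r : ℝ≥0∞) : Measure ℝ≥0∞ :=
  (volume.restrict (Set.Ioc (0 : ℝ) 1)).map (extremalVar φ r)

section

variable {φ Φ : ℝ≥0∞ → ℝ≥0∞} {r : ℝ≥0∞}

lemma ofReal_mem_Ioc {w : ℝ} (hw : w ∈ Set.Ioc (0 : ℝ) 1) :
    ENNReal.ofReal w ∈ Set.Ioc (0 : ℝ≥0∞) 1 :=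
  ⟨ENNReal.ofReal_pos.2 hw.1, ENNReal.ofReal_le_one.2 hw.2⟩

lemma one_le_extremalVar (w : ℝ) : 1 ≤ extremalVar φ r w := by
  unfold extremalVar
  split_ifs <;> simp

lemma extremalVar_of_mem {w : ℝ} (hw : w ∈ Set.Ioc (0 : ℝ) 1) :
    extremalVar φ r w = max 1 (r * φ (ENNReal.ofReal w)) := by
  rw [extremalVar, if_neg (not_le.2 hw.1), min_eq_left hw.2]

lemma monotone_extremalVar (hφ : StrictMonoOn φ (Set.Ioc 0 1)) :
    Monotone (extremalVar φ r) := by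
  intro v w hvw
  by_cases hv : v ≤ 0
  · rw [extremalVar, if_pos hv]
    exact one_le_extremalVar w
  · push Not at hv
    have hw : 0 < w := hv.trans_le hvw
    rw [extremalVar, extremalVar, if_neg hv.not_ge, if_neg hw.not_ge]
    have hmem : ∀ x : ℝ, 0 < x → ENNReal.ofReal (min x 1) ∈ Set.Ioc (0 : ℝ≥0∞) 1 := fun x hx =>
      ofReal_mem_Ioc ⟨lt_min hx one_pos, min_le_right _ _⟩
    have := hφ.monotoneOn (hmem v hv) (hmem w hw)
      (ENNReal.ofReal_le_ofReal (min_le_min_right 1 hvw))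
    gcongr

lemma isProbabilityMeasure_extremalLaw (hφ : StrictMonoOn φ (Set.Ioc 0 1)) :
    IsProbabilityMeasure (extremalLaw φ r) := by
  constructor
  rw [extremalLaw, Measure.map_apply (monotone_extremalVar hφ).measurable MeasurableSet.univ]
  simp

lemma extremalLaw_Iio_one (hφ : StrictMonoOn φ (Set.Ioc 0 1)) :
    extremalLaw φ r (Set.Iio 1) = 0 := by
  rw [extremalLaw, Measure.map_apply (monotone_extremalVar hφ).measurable measurableSet_Iio]
  have : extremalVar φ r ⁻¹' Set.Iio 1 = ∅ := by
    ext w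
    simpa using one_le_extremalVar w
  simp [this]

lemma mul_le_quantileD_extremalLaw (hφ : StrictMonoOn φ (Set.Ioc 0 1))
    (hφc : ContinuousOn φ (Set.Ioc 0 1)) (hr0 : r ≠ 0) (hr : r ≠ ⊤)
    {q : ℝ≥0∞} (hq : q ∈ Set.Ioc (0 : ℝ≥0∞) 1) :
    r * φ q ≤ quantileD (extremalLaw φ r) q := by
  refine le_sInf fun α ⟨_, _, hqα⟩ => ?_
  by_contra! hlt
  have hlt' : α / r < φ q := by
    rw [ENNReal.div_lt_iff (Or.inl hr0) (Or.inl hr), mul_comm]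
    exact hlt
  have hev : ∀ᶠ x in nhdsWithin q (Set.Iio q), α / r < φ x := by
    have h := (hφc q hq).eventually (lt_mem_nhds hlt')
    refine (nhdsWithin_le_of_mem ?_) h
    exact mem_of_superset (Ioo_mem_nhdsLT hq.1) fun x hx => ⟨hx.1, hx.2.le.trans hq.2⟩
  have : (nhdsWithin q (Set.Iio q)).NeBot := nhdsLT_neBot_of_exists_lt ⟨0, hq.1⟩
  obtain ⟨x, hx, hxq⟩ := (hev.and (Ioo_mem_nhdsLT hq.1)).exists
  have hxmem : x ∈ Set.Ioc (0 : ℝ≥0∞) 1 := ⟨hxq.1, hxq.2.le.trans hq.2⟩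
  have hxtop : x ≠ ⊤ := hxq.2.ne_top
  rw [extremalLaw, Measure.map_apply (monotone_extremalVar hφ).measurable measurableSet_Iic,
    Measure.restrict_apply ((monotone_extremalVar hφ).measurable measurableSet_Iic)] at hqα
  have hsub : extremalVar φ r ⁻¹' Set.Iic α ∩ Set.Ioc 0 1 ⊆ Set.Ioc 0 x.toReal := by
    rintro w ⟨hwα, hw⟩
    refine ⟨hw.1, ?_⟩
    by_contra! hxw
    rw [Set.mem_preimage, Set.mem_Iic, extremalVar_of_mem hw] at hwα
    have hle : x ≤ ENNReal.ofReal w := (ENNReal.le_ofReal_iff_toReal_le hxtop hw.1.le).2 hxw.le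
    have hφle := hφ.monotoneOn hxmem (ofReal_mem_Ioc hw) hle
    have : φ (ENNReal.ofReal w) ≤ α / r := by
      rw [ENNReal.le_div_iff_mul_le (Or.inl hr0) (Or.inl hr), mul_comm]
      exact (le_max_right _ _).trans hwα
    exact (hx.trans_le hφle).not_ge this
  have := hqα.trans (measure_mono hsub)
  rw [Real.volume_Ioc, sub_zero, ENNReal.ofReal_toReal hxtop] at this
  exact hxq.2.not_ge this

lemma le_iInf_quantileD_div (hφ : StrictMonoOn φ (Set.Ioc 0 1))
    (hφc : ContinuousOn φ (Set.Ioc 0 1))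
    (hφmem : ∀ x ∈ Set.Ioc (0 : ℝ≥0∞) 1, 0 < φ x ∧ φ x ≠ ⊤) (hr0 : r ≠ 0) (hr : r ≠ ⊤) :
    r ≤ ⨅ q ∈ Set.Ioc (0 : ℝ≥0∞) 1, quantileD (extremalLaw φ r) q / φ q := by
  refine le_iInf₂ fun q hq => ?_
  rw [ENNReal.le_div_iff_mul_le (Or.inl (hφmem q hq).1.ne') (Or.inl (hφmem q hq).2)]
  exact mul_le_quantileD_extremalLaw hφ hφc hr0 hr hq

lemma upInv_mono {x y : ℝ≥0∞} (h : x ≤ y) : upInv Φ x ≤ upInv Φ y :=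
  sInf_le_sInf fun _ ht => ⟨ht.1, h.trans ht.2⟩

/-- The inverse `φ⁻¹(Φ⁻¹(u)/r)` is at most the probability of `Φ(max(1, rφ(U))) < u`. -/
lemma lowInv_le_volume (hr0 : r ≠ 0) (hr : r ≠ ⊤) (hM : 1 ≤ r * φ 1)
    {v : ℝ≥0∞} (hv1 : Φ 1 < v) (hvM : v ≤ Φ (r * φ 1)) :
    lowInv φ (upInv Φ v / r) ≤
      volume ({w | Φ (extremalVar φ r w) < v} ∩ Set.Ioc (0 : ℝ) 1) := by
  set L := lowInv φ (upInv Φ v / r) with hL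
  have hL1 : L ≤ 1 := by
    refine sInf_le ⟨⟨one_pos, le_rfl⟩, ?_⟩
    rw [ENNReal.div_le_iff_le_mul (Or.inl hr0) (Or.inl hr), mul_comm]
    exact sInf_le ⟨hM, hvM⟩
  have hLtop : L ≠ ⊤ := (hL1.trans_lt ENNReal.one_lt_top).ne
  have hsub : Set.Ioo 0 L.toReal ⊆ {w | Φ (extremalVar φ r w) < v} ∩ Set.Ioc (0 : ℝ) 1 := by
    intro w hw
    have hwmem : w ∈ Set.Ioc (0 : ℝ) 1 :=
      ⟨hw.1, hw.2.le.trans (ENNReal.toReal_le_of_le_ofReal zero_le_one (by simpa using hL1))⟩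
    have hwL : ENNReal.ofReal w < L := (ENNReal.ofReal_lt_iff_lt_toReal hw.1.le hLtop).2 hw.2
    have hlt : r * φ (ENNReal.ofReal w) < upInv Φ v := by
      by_contra! hle
      refine hwL.not_ge (sInf_le ⟨ofReal_mem_Ioc hwmem, ?_⟩)
      rw [ENNReal.div_le_iff_le_mul (Or.inl hr0) (Or.inl hr), mul_comm]
      exact hle
    refine ⟨?_, hwmem⟩
    rw [Set.mem_ofPred_eq, extremalVar_of_mem hwmem]
    rcases le_total (r * φ (ENNReal.ofReal w)) 1 with h | h
    · rwa [max_eq_left h]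
    · rw [max_eq_right h]
      by_contra! hle
      exact hlt.not_ge (sInf_le ⟨h, hle⟩)
  calc L = volume (Set.Ioo 0 L.toReal) := by
        rw [Real.volume_Ioo, sub_zero, ENNReal.ofReal_toReal hLtop]
    _ ≤ _ := measure_mono hsub

/-- For `g ≤ b` almost surely, `E[g] + ∫_a^b P(g < u) du ≤ b`. -/
lemma lintegral_add_lintegral_measure_lt_le {Ω : Type*} [MeasurableSpace Ω] {μ : Measure Ω}
    [IsProbabilityMeasure μ] {g : Ω → ℝ≥0∞} (hg : Measurable g) {a b : ℝ≥0∞}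
    (hb : b ≠ ⊤) (hgb : ∀ᵐ w ∂μ, g w ≤ b) :
    (∫⁻ w, g w ∂μ) + ∫⁻ u in Set.Ioc a.toReal b.toReal, μ {w | g w < ENNReal.ofReal u} ≤ b := by
  have hmeas : MeasurableSet {z : ℝ × Ω | g z.2 < ENNReal.ofReal z.1} :=
    measurableSet_lt (hg.comp measurable_snd) (ENNReal.measurable_ofReal.comp measurable_fst)
  have hswap : ∫⁻ u in Set.Ioc a.toReal b.toReal, μ {w | g w < ENNReal.ofReal u}
      = ∫⁻ w, (volume.restrict (Set.Ioc a.toReal b.toReal)) {u | g w < ENNReal.ofReal u} ∂μ := by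
    exact (Measure.prod_apply (μ := volume.restrict (Set.Ioc a.toReal b.toReal)) (ν := μ)
      hmeas).symm.trans (Measure.prod_apply_symm hmeas)
  rw [hswap, ← lintegral_add_left hg]
  calc _ ≤ ∫⁻ _, b ∂μ := by
        refine lintegral_mono_ae ?_
        filter_upwards [hgb] with w hw
        have hwtop : g w ≠ ⊤ := (hw.trans_lt hb.lt_top).ne
        have hsub : {u | g w < ENNReal.ofReal u} ∩ Set.Ioc a.toReal b.toReal
            ⊆ Set.Ioc (g w).toReal b.toReal := fun u hu =>
          ⟨(ENNReal.lt_ofReal_iff_toReal_lt hwtop).1 hu.1, hu.2.2⟩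
        have hle : (volume.restrict (Set.Ioc a.toReal b.toReal)) {u | g w < ENNReal.ofReal u}
            ≤ b - g w := by
          rw [Measure.restrict_apply' measurableSet_Ioc]
          refine (measure_mono hsub).trans ?_
          rw [Real.volume_Ioc, ENNReal.ofReal_sub _ ENNReal.toReal_nonneg,
            ENNReal.ofReal_toReal hb, ENNReal.ofReal_toReal hwtop]
        calc _ ≤ g w + (b - g w) := by gcongr
          _ = b := add_tsub_cancel_of_le hw
    _ = b := by simp

lemma lintegral_extremalLaw_le (hφ : StrictMonoOn φ (Set.Ioc 0 1))
    (hφ1 : φ 1 ≠ ⊤) (hΦ : StrictMonoOn Φ (Set.Ici 1))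
    (hΦfin : ∀ t : ℝ≥0∞, 1 ≤ t → t ≠ ⊤ → Φ t ≠ ⊤)
    (hr0 : r ≠ 0) (hr : r ≠ ⊤) (hM : 1 ≤ r * φ 1) :
    ∫⁻ t, Φ t ∂extremalLaw φ r ≤ Φ (r * φ 1)
      - ∫⁻ u in Set.Ioc (Φ 1).toReal (Φ (r * φ 1)).toReal,
          lowInv φ (upInv Φ (ENNReal.ofReal u) / r) := by
  have hmono := monotone_extremalVar (r := r) hφ
  have hg : Monotone fun w => Φ (extremalVar φ r w) := fun v w hvw =>
    hΦ.monotoneOn (one_le_extremalVar v) (one_le_extremalVar w) (hmono hvw)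
  have hb : Φ (r * φ 1) ≠ ⊤ := hΦfin _ hM (ENNReal.mul_ne_top hr hφ1)
  have h1 : Φ 1 ≠ ⊤ := hΦfin 1 le_rfl ENNReal.one_ne_top
  have : IsProbabilityMeasure (volume.restrict (Set.Ioc (0 : ℝ) 1)) := ⟨by simp⟩
  have hgb : ∀ᵐ w ∂volume.restrict (Set.Ioc (0 : ℝ) 1),
      Φ (extremalVar φ r w) ≤ Φ (r * φ 1) := by
    filter_upwards [ae_restrict_mem measurableSet_Ioc] with w hw
    refine hΦ.monotoneOn (one_le_extremalVar w) hM ?_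
    rw [extremalVar_of_mem hw]
    refine max_le hM ?_
    have := hφ.monotoneOn (ofReal_mem_Ioc hw) ⟨one_pos, le_rfl⟩ (ofReal_mem_Ioc hw).2
    gcongr
  have hkey := lintegral_add_lintegral_measure_lt_le (a := Φ 1) hg.measurable hb hgb
  have hlow : ∫⁻ u in Set.Ioc (Φ 1).toReal (Φ (r * φ 1)).toReal,
      lowInv φ (upInv Φ (ENNReal.ofReal u) / r) ≤
      ∫⁻ u in Set.Ioc (Φ 1).toReal (Φ (r * φ 1)).toReal,
        (volume.restrict (Set.Ioc (0 : ℝ) 1)) {w | Φ (extremalVar φ r w) < ENNReal.ofReal u} := by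
    refine setLIntegral_mono' measurableSet_Ioc fun u hu => ?_
    rw [Measure.restrict_apply' measurableSet_Ioc]
    exact lowInv_le_volume hr0 hr hM ((ENNReal.lt_ofReal_iff_toReal_lt h1).2 hu.1)
      (ENNReal.ofReal_le_of_le_toReal hu.2)
  have hint : ∫⁻ t, Φ t ∂extremalLaw φ r ≤
      ∫⁻ w in Set.Ioc (0 : ℝ) 1, Φ (extremalVar φ r w) :=
    lintegral_map_le _ _
  have hsum := (add_le_add hint hlow).trans hkey
  exact ENNReal.le_sub_of_add_le_right
    (((le_add_self).trans hsum).trans_lt hb.lt_top).ne hsum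

end

/-- If a constant `C' > 0` is such that, for every random variable `T` with values in
`[1,∞]` (equivalently, every probability distribution `p` on `[1,∞]`),
`inf_{q ∈ (0,1]} Q_p(q)/φ(q) ≤ C' · Φ⁻¹(E[Φ(T)])`, then
`C' ≥ 1 / inf_{r ≥ 1/φ(1)} c_{Φ,φ}(r)`; in particular, if
`inf_{r ≥ 1/φ(1)} c_{Φ,φ}(r) = 0`, then no finite constant `C'` works. -/
theorem stmt8 (φ Φ : ℝ≥0∞ → ℝ≥0∞)
    (hφmono : StrictMonoOn φ (Set.Ioc 0 1)) (hφcont : ContinuousOn φ (Set.Ioc 0 1))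
    (hφmem : ∀ x ∈ Set.Ioc (0 : ℝ≥0∞) 1, 0 < φ x ∧ φ x ≠ ⊤)
    (hφinf : (⨅ x ∈ Set.Ioc (0 : ℝ≥0∞) 1, φ x) = 0)
    (hΦmono : StrictMonoOn Φ (Set.Ici 1)) (hΦcont : ContinuousOn Φ (Set.Ici 1))
    (hΦfin : ∀ t : ℝ≥0∞, 1 ≤ t → t ≠ ⊤ → Φ t ≠ ⊤)
    (C' : ℝ≥0∞) (hC' : 0 < C')
    (hbound : ∀ (p : Measure ℝ≥0∞), IsProbabilityMeasure p → p (Set.Iio 1) = 0 →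
        (⨅ q ∈ Set.Ioc (0 : ℝ≥0∞) 1, quantileD p q / φ q)
          ≤ C' * upInv Φ (∫⁻ t, Φ t ∂p)) :
    (⨅ r ∈ Set.Ico (φ 1)⁻¹ (⊤ : ℝ≥0∞), cFun φ Φ r)⁻¹ ≤ C'
      ∧ ((⨅ r ∈ Set.Ico (φ 1)⁻¹ (⊤ : ℝ≥0∞), cFun φ Φ r) = 0 → C' = ⊤) := by
  have hφ1 := hφmem 1 ⟨one_pos, le_rfl⟩
  have hmain : (⨅ r ∈ Set.Ico (φ 1)⁻¹ (⊤ : ℝ≥0∞), cFun φ Φ r)⁻¹ ≤ C' := by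
    rw [ENNReal.inv_le_iff_inv_le]
    refine le_iInf₂ fun r hr => ?_
    have hrtop : r ≠ ⊤ := hr.2.ne
    have hr0 : r ≠ 0 := ((ENNReal.inv_pos.2 hφ1.2).trans_le hr.1).ne'
    have hM : 1 ≤ r * φ 1 := by
      calc 1 = (φ 1)⁻¹ * φ 1 := (ENNReal.inv_mul_cancel hφ1.1.ne' hφ1.2).symm
        _ ≤ r * φ 1 := by gcongr; exact hr.1
    have hle : r ≤ C' * (cFun φ Φ r * r) := by
      refine (le_iInf_quantileD_div hφmono hφcont hφmem hr0 hrtop).trans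
        ((hbound _ (isProbabilityMeasure_extremalLaw hφmono)
          (extremalLaw_Iio_one hφmono)).trans ?_)
      rw [cFun, ENNReal.div_mul_cancel hr0 hrtop]
      gcongr
      exact upInv_mono (lintegral_extremalLaw_le hφmono hφ1.2 hΦmono hΦfin hr0 hrtop hM)
    have hone : 1 ≤ C' * cFun φ Φ r := by
      rw [← ENNReal.mul_le_mul_iff_left hr0 hrtop, one_mul]
      calc r ≤ C' * (cFun φ Φ r * r) := hle
        _ = C' * cFun φ Φ r * r := by ring
    refine (ENNReal.inv_le_iff_le_mul (fun _ => hC'.ne') fun _ hc => ?_).2 hone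
    simp [hc] at hone
  refine ⟨hmain, fun h0 => ?_⟩
  rwa [h0, ENNReal.inv_zero, top_le_iff] at hmain
end

section
/- Let φ : (0,1] → (0,∞) be strictly increasing and continuous with inf φ = 0, let Φ : [1,∞) → [0,∞) be strictly increasing and continuous, and let r ≥ 1/φ(1). Let T_r be a random variable with values in [1,∞) whose cumulative distribution function is P(T_r ≤ α) = min{φ^{−1}(α/r), 1} for α ≥ 1 and 0 for α < 1. Then: (i) inf_{q∈(0,1]} Q_{p_r}(q)/φ(q) = r, where p_r is the law of T_r; and (ii) E[Φ(T_r)] = Φ(1) + ∫_{Φ(1)}^{Φ(rφ(1))} (1 − φ^{−1}( Φ^{−1}(u)/r )) du, so that Φ^{−1}(E[Φ(T_r)]) = r·c_{Φ,φ}(r), where c_{Φ,φ}(r) = (1/r)·Φ^{−1}( Φ(rφ(1)) − ∫_{Φ(1)}^{Φ(rφ(1))} φ^{−1}( Φ^{−1}(u)/r ) du ). -/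
open MeasureTheory ENNReal Filter

lemma lowInv_mono (φ : ℝ≥0∞ → ℝ≥0∞) : Monotone (lowInv φ) :=
  fun _ _ h => sInf_le_sInf fun _ hx => ⟨hx.1, h.trans hx.2⟩

lemma upInv_mono_s9 (Φ : ℝ≥0∞ → ℝ≥0∞) : Monotone (upInv Φ) :=
  fun _ _ h => sInf_le_sInf fun _ hx => ⟨hx.1, h.trans hx.2⟩

lemma le_lowInv_iff {φ : ℝ≥0∞ → ℝ≥0∞} (hφmono : StrictMonoOn φ (Set.Ioc 0 1))
    (hφcont : ContinuousOn φ (Set.Ioc 0 1)) {q : ℝ≥0∞} (hq : q ∈ Set.Ioc 0 1) (y : ℝ≥0∞) :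
    q ≤ lowInv φ y ↔ φ q ≤ y := by
  constructor
  · intro h
    by_contra! hy
    have hev : ∀ᶠ x in nhdsWithin q (Set.Ioo 0 q), y < φ x :=
      ((hφcont q hq).mono fun x hx => ⟨hx.1, hx.2.le.trans hq.2⟩).eventually
        (lt_mem_nhds hy)
    have : (nhdsWithin q (Set.Ioo 0 q)).NeBot := by
      rw [nhdsWithin_Ioo_eq_nhdsLT hq.1]
      exact nhdsLT_neBot_of_exists_lt ⟨0, hq.1⟩
    obtain ⟨x, hyx, hx⟩ := (hev.and self_mem_nhdsWithin).exists
    have hle : lowInv φ y ≤ x := sInf_le ⟨⟨hx.1, hx.2.le.trans hq.2⟩, hyx.le⟩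
    exact absurd (h.trans hle) (not_le.mpr hx.2)
  · intro h
    exact le_sInf fun x hx => (hφmono.le_iff_le hq hx.1).1 (h.trans hx.2)

lemma upInv_apply {Φ : ℝ≥0∞ → ℝ≥0∞} (hΦmono : StrictMonoOn Φ (Set.Ici 1)) {s : ℝ≥0∞}
    (hs : 1 ≤ s) : upInv Φ (Φ s) = s :=
  le_antisymm (sInf_le ⟨hs, le_rfl⟩)
    (le_sInf fun _ ht => (hΦmono.le_iff_le hs ht.1).1 ht.2)

lemma exists_mem_Icc_of_mem_Ioc {Φ : ℝ≥0∞ → ℝ≥0∞} (hΦcont : ContinuousOn Φ (Set.Ici 1))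
    {M : ℝ≥0∞} (hM : 1 ≤ M) (h1 : Φ 1 ≠ ⊤) {u : ℝ}
    (hu : u ∈ Set.Ioc (Φ 1).toReal (Φ M).toReal) :
    ∃ s ∈ Set.Icc 1 M, Φ s = ENNReal.ofReal u := by
  refine intermediate_value_Icc hM (hΦcont.mono Set.Icc_subset_Ici_self) ⟨?_, ?_⟩
  · exact (ENNReal.le_ofReal_iff_toReal_le h1 (toReal_nonneg.trans hu.1.le)).2 hu.1.le
  · exact ENNReal.ofReal_le_of_le_toReal hu.2

/-- Layer-cake formula for a monotone function of a variable supported in `[1, M]`. -/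
lemma lintegral_eq_add_lintegral_upInv {Φ : ℝ≥0∞ → ℝ≥0∞}
    (hΦmono : StrictMonoOn Φ (Set.Ici 1)) (hΦcont : ContinuousOn Φ (Set.Ici 1))
    {M : ℝ≥0∞} (hM : 1 ≤ M) (h1 : Φ 1 ≠ ⊤) (hΦM : Φ M ≠ ⊤)
    (p : Measure ℝ≥0∞) [IsProbabilityMeasure p] (hp : ∀ᵐ t ∂p, t ∈ Set.Icc 1 M) :
    ∫⁻ t, Φ t ∂p = Φ 1 + ∫⁻ u in Set.Ioc (Φ 1).toReal (Φ M).toReal,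
      (1 - p (Set.Iic (upInv Φ (ENNReal.ofReal u)))) := by
  set c : ℝ≥0∞ → ℝ≥0∞ := fun t => max 1 (min t M) with hc
  have hc1 : ∀ t, 1 ≤ c t := fun t => le_max_left _ _
  have hcM : ∀ t, c t ≤ M := fun t => max_le hM (min_le_right _ _)
  have hcid : ∀ t ∈ Set.Icc 1 M, c t = t := fun t ht => by
    simp [hc, min_eq_left ht.2, max_eq_right ht.1]
  have hmono : Monotone fun t => Φ (c t) := fun x y h =>
    hΦmono.monotoneOn (hc1 x) (hc1 y) (max_le_max le_rfl (min_le_min h le_rfl))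
  have hfin : ∀ t, Φ (c t) ≠ ⊤ := fun t =>
    ne_top_of_le_ne_top hΦM (hΦmono.monotoneOn (hc1 t) hM (hcM t))
  have hab : (Φ 1).toReal ≤ (Φ M).toReal :=
    ENNReal.toReal_mono hΦM (hΦmono.monotoneOn Set.self_mem_Ici hM hM)
  have hlow : ∀ t, (Φ 1).toReal ≤ (Φ (c t)).toReal := fun t =>
    ENNReal.toReal_mono (hfin t) (hΦmono.monotoneOn Set.self_mem_Ici (hc1 t) (hc1 t))
  have hhigh : ∀ t, (Φ (c t)).toReal ≤ (Φ M).toReal := fun t =>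
    ENNReal.toReal_mono hΦM (hΦmono.monotoneOn (hc1 t) hM (hcM t))
  have hmeas : Measurable fun t => (Φ (c t)).toReal := hmono.measurable.ennreal_toReal
  calc ∫⁻ t, Φ t ∂p = ∫⁻ t, ENNReal.ofReal (Φ (c t)).toReal ∂p := by
        refine lintegral_congr_ae ?_
        filter_upwards [hp] with t ht
        rw [ENNReal.ofReal_toReal (hfin t), hcid t ht]
    _ = ∫⁻ u in Set.Ioi 0, p {t | u < (Φ (c t)).toReal} :=
        lintegral_eq_lintegral_meas_lt p (Eventually.of_forall fun _ => toReal_nonneg)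
          hmeas.aemeasurable
    _ = (∫⁻ u in Set.Ioc 0 (Φ 1).toReal, p {t | u < (Φ (c t)).toReal})
        + ((∫⁻ u in Set.Ioc (Φ 1).toReal (Φ M).toReal, p {t | u < (Φ (c t)).toReal})
          + ∫⁻ u in Set.Ioi (Φ M).toReal, p {t | u < (Φ (c t)).toReal}) := by
        rw [← lintegral_union measurableSet_Ioi
            (Set.Ioc_disjoint_Ioi le_rfl), Set.Ioc_union_Ioi_eq_Ioi hab,
          ← lintegral_union measurableSet_Ioi (Set.Ioc_disjoint_Ioi le_rfl),
          Set.Ioc_union_Ioi_eq_Ioi toReal_nonneg]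
    _ = Φ 1 + ∫⁻ u in Set.Ioc (Φ 1).toReal (Φ M).toReal,
          (1 - p (Set.Iic (upInv Φ (ENNReal.ofReal u)))) := by
        congr 1
        · rw [← restrict_Ioo_eq_restrict_Ioc]
          rw [setLIntegral_congr_fun (g := fun _ => 1) measurableSet_Ioo]
          · simp [ENNReal.ofReal_toReal h1]
          · intro u hu
            have : {t | u < (Φ (c t)).toReal} = Set.univ :=
              Set.eq_univ_of_forall fun t => hu.2.trans_le (hlow t)
            simp [this]
        · have hzero : ∫⁻ u in Set.Ioi (Φ M).toReal, p {t | u < (Φ (c t)).toReal} = 0 := by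
            rw [setLIntegral_congr_fun (g := fun _ => 0) measurableSet_Ioi]
            · simp
            · intro u hu
              have : {t | u < (Φ (c t)).toReal} = ∅ :=
                Set.eq_empty_of_forall_notMem fun t ht =>
                  lt_irrefl _ ((ht.trans_le (hhigh t)).trans hu)
              simp [this]
          rw [hzero, add_zero]
          refine setLIntegral_congr_fun measurableSet_Ioc fun u hu => ?_
          obtain ⟨s, hs, hsu⟩ := exists_mem_Icc_of_mem_Ioc hΦcont hM h1 hu
          have hu0 : 0 ≤ u := toReal_nonneg.trans hu.1.le
          rw [← hsu, upInv_apply hΦmono hs.1, ← prob_compl_eq_one_sub measurableSet_Iic]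
          refine measure_congr ?_
          filter_upwards [hp] with t ht
          refine propext ?_
          change u < (Φ (c t)).toReal ↔ ¬ t ≤ s
          rw [hcid t ht, not_le, ← hΦmono.lt_iff_lt hs.1 ht.1, hsu,
            ENNReal.ofReal_lt_iff_lt_toReal hu0 (hcid t ht ▸ hfin t)]

lemma quantileD_eq_max {φ : ℝ≥0∞ → ℝ≥0∞} (hφmono : StrictMonoOn φ (Set.Ioc 0 1))
    (hφcont : ContinuousOn φ (Set.Ioc 0 1)) {r : ℝ≥0∞} (hr0 : r ≠ 0) (hrfin : r ≠ ⊤)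
    {p : Measure ℝ≥0∞}
    (hcdf : ∀ α : ℝ≥0∞, 1 ≤ α → α ≠ ⊤ → p (Set.Iic α) = min (lowInv φ (α / r)) 1)
    {q : ℝ≥0∞} (hq : q ∈ Set.Ioc 0 1) (hφq : φ q ≠ ⊤) :
    quantileD p q = max 1 (φ q * r) := by
  have hiff : ∀ α : ℝ≥0∞, 1 ≤ α → α ≠ ⊤ → (q ≤ p (Set.Iic α) ↔ φ q * r ≤ α) := by
    intro α h1 htop
    rw [hcdf α h1 htop, le_min_iff, le_lowInv_iff hφmono hφcont hq,
      ENNReal.le_div_iff_mul_le (Or.inl hr0) (Or.inl hrfin)]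
    exact and_iff_left hq.2
  have hfin : max 1 (φ q * r) ≠ ⊤ :=
    (max_lt one_lt_top (ENNReal.mul_lt_top hφq.lt_top hrfin.lt_top)).ne
  refine le_antisymm (sInf_le ⟨le_max_left _ _, hfin, ?_⟩) (le_sInf ?_)
  · exact (hiff _ (le_max_left _ _) hfin).2 (le_max_right _ _)
  · rintro α ⟨h1, htop, hα⟩
    exact max_le h1 ((hiff α h1 htop).1 hα)

/-- For `r ≥ 1/φ(1)` and `T_r ~ p_r` the random variable with values in `[1,∞)` whose
CDF is `P(T_r ≤ α) = min{φ⁻¹(α/r), 1}` for `α ≥ 1` (and `0` for `α < 1`):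
(i) `inf_{q ∈ (0,1]} Q_{p_r}(q)/φ(q) = r`, and
(ii) `E[Φ(T_r)] = Φ(1) + ∫_{Φ(1)}^{Φ(rφ(1))} (1 - φ⁻¹(Φ⁻¹(u)/r)) du`, so that
`Φ⁻¹(E[Φ(T_r)]) = r · c_{Φ,φ}(r)`. -/
theorem stmt9 (φ Φ : ℝ≥0∞ → ℝ≥0∞)
    (hφmono : StrictMonoOn φ (Set.Ioc 0 1)) (hφcont : ContinuousOn φ (Set.Ioc 0 1))
    (hφmem : ∀ x ∈ Set.Ioc (0 : ℝ≥0∞) 1, 0 < φ x ∧ φ x ≠ ⊤)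
    (hφinf : (⨅ x ∈ Set.Ioc (0 : ℝ≥0∞) 1, φ x) = 0)
    (hΦmono : StrictMonoOn Φ (Set.Ici 1)) (hΦcont : ContinuousOn Φ (Set.Ici 1))
    (hΦfin : ∀ t : ℝ≥0∞, 1 ≤ t → t ≠ ⊤ → Φ t ≠ ⊤)
    (r : ℝ≥0∞) (hr : (φ 1)⁻¹ ≤ r) (hrfin : r ≠ ⊤)
    (pr : Measure ℝ≥0∞) (hprob : IsProbabilityMeasure pr)
    (hcdf : ∀ α : ℝ≥0∞, α ≠ ⊤ →
        pr (Set.Iic α) = if 1 ≤ α then min (lowInv φ (α / r)) 1 else 0)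
    (hnotop : pr {⊤} = 0) :
    (⨅ q ∈ Set.Ioc (0 : ℝ≥0∞) 1, quantileD pr q / φ q) = r
      ∧ (∫⁻ t, Φ t ∂pr)
          = Φ 1 + ∫⁻ u in Set.Ioc (Φ 1).toReal (Φ (r * φ 1)).toReal,
              (1 - lowInv φ (upInv Φ (ENNReal.ofReal u) / r))
      ∧ upInv Φ (∫⁻ t, Φ t ∂pr) = r * cFun φ Φ r := by
  have h1mem : (1 : ℝ≥0∞) ∈ Set.Ioc (0 : ℝ≥0∞) 1 := ⟨one_pos, le_rfl⟩
  obtain ⟨hφ1pos, hφ1top⟩ := hφmem 1 h1mem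
  have hr0 : r ≠ 0 := ((ENNReal.inv_pos.2 hφ1top).trans_le hr).ne'
  have hM : 1 ≤ r * φ 1 := by
    calc 1 = (φ 1)⁻¹ * φ 1 := (ENNReal.inv_mul_cancel hφ1pos.ne' hφ1top).symm
      _ ≤ r * φ 1 := mul_le_mul_left hr _
  have hMtop : r * φ 1 ≠ ⊤ := ENNReal.mul_ne_top hrfin hφ1top
  have hcdf' : ∀ α : ℝ≥0∞, 1 ≤ α → α ≠ ⊤ →
      pr (Set.Iic α) = min (lowInv φ (α / r)) 1 := fun α h1 htop => by
    rw [hcdf α htop, if_pos h1]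
  have hΦ1 : Φ 1 ≠ ⊤ := hΦfin 1 le_rfl one_ne_top
  have hΦM : Φ (r * φ 1) ≠ ⊤ := hΦfin _ hM hMtop
  have hab : (Φ 1).toReal ≤ (Φ (r * φ 1)).toReal :=
    ENNReal.toReal_mono hΦM (hΦmono.monotoneOn Set.self_mem_Ici hM hM)
  have hsupp : ∀ᵐ t ∂pr, t ∈ Set.Icc 1 (r * φ 1) := by
    have hlow : ∀ᵐ t ∂pr, ∀ n : ℕ, ¬ t ≤ 1 - ((n : ℝ≥0∞) + 1)⁻¹ := by
      refine ae_all_iff.2 fun n => ?_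
      have hlt : (1 : ℝ≥0∞) - ((n : ℝ≥0∞) + 1)⁻¹ < 1 :=
        ENNReal.sub_lt_self one_ne_top one_ne_zero (by simp)
      have h0 : pr (Set.Iic (1 - ((n : ℝ≥0∞) + 1)⁻¹)) = 0 := by
        rw [hcdf _ (hlt.trans one_lt_top).ne, if_neg (not_le.2 hlt)]
      exact measure_eq_zero_iff_ae_notMem.1 h0
    have hhigh : ∀ᵐ t ∂pr, t ∈ Set.Iic (r * φ 1) := by
      have hone : pr (Set.Iic (r * φ 1)) = 1 := by
        rw [hcdf' _ hM hMtop, mul_comm, ENNReal.mul_div_cancel_right hr0 hrfin]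
        exact min_eq_right ((le_lowInv_iff hφmono hφcont h1mem _).2 le_rfl)
      exact (prob_compl_eq_zero_iff measurableSet_Iic).2 hone
    filter_upwards [hlow, hhigh] with t ht ht'
    refine ⟨?_, ht'⟩
    by_contra! hlt
    obtain ⟨n, hn⟩ := ENNReal.exists_inv_nat_lt (tsub_pos_of_lt hlt).ne'
    have hn1 : ((n : ℝ≥0∞) + 1)⁻¹ ≤ 1 - t :=
      (ENNReal.inv_le_inv.2 le_self_add).trans hn.le
    exact ht n (ENNReal.le_sub_of_add_le_left (by simp) (by
      rw [add_comm]
      exact add_le_of_le_tsub_left_of_le hlt.le hn1))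
  have hlint : ∫⁻ t, Φ t ∂pr = Φ 1 + ∫⁻ u in Set.Ioc (Φ 1).toReal (Φ (r * φ 1)).toReal,
      (1 - lowInv φ (upInv Φ (ENNReal.ofReal u) / r)) := by
    rw [lintegral_eq_add_lintegral_upInv hΦmono hΦcont hM hΦ1 hΦM pr hsupp]
    congr 1
    refine setLIntegral_congr_fun measurableSet_Ioc fun u hu => ?_
    obtain ⟨s, hs, hsu⟩ := exists_mem_Icc_of_mem_Ioc hΦcont hM hΦ1 hu
    rw [← hsu, upInv_apply hΦmono hs.1, hcdf' s hs.1 (ne_top_of_le_ne_top hMtop hs.2)]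
    rcases le_total (lowInv φ (s / r)) 1 with h | h
    · rw [min_eq_left h]
    · rw [min_eq_right h, tsub_self, tsub_eq_zero_of_le h]
  refine ⟨?_, hlint, ?_⟩
  · refine le_antisymm ?_ (le_iInf₂ fun q hq => ?_)
    · refine (iInf₂_le 1 h1mem).trans ?_
      rw [quantileD_eq_max hφmono hφcont hr0 hrfin hcdf' h1mem hφ1top, mul_comm,
        max_eq_right hM, ENNReal.mul_div_cancel_right hφ1pos.ne' hφ1top]
    · obtain ⟨hpos, htop⟩ := hφmem q hq
      rw [quantileD_eq_max hφmono hφcont hr0 hrfin hcdf' hq htop,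
        ENNReal.le_div_iff_mul_le (Or.inl hpos.ne') (Or.inl htop), mul_comm]
      exact le_max_right _ _
  · rw [cFun, ENNReal.mul_div_cancel hr0 hrfin, hlint]
    congr 1
    have hmeas : Measurable fun u : ℝ => lowInv φ (upInv Φ (ENNReal.ofReal u) / r) :=
      Monotone.measurable fun x y h => lowInv_mono φ <|
        ENNReal.div_le_div_right (upInv_mono_s9 Φ (ENNReal.ofReal_le_ofReal h)) r
    have hle : ∀ u ∈ Set.Ioc (Φ 1).toReal (Φ (r * φ 1)).toReal,
        lowInv φ (upInv Φ (ENNReal.ofReal u) / r) ≤ 1 := by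
      intro u hu
      obtain ⟨s, hs, hsu⟩ := exists_mem_Icc_of_mem_Ioc hΦcont hM hΦ1 hu
      rw [← hsu, upInv_apply hΦmono hs.1]
      exact sInf_le ⟨h1mem, ENNReal.div_le_of_le_mul' hs.2⟩
    have hsum : (∫⁻ u in Set.Ioc (Φ 1).toReal (Φ (r * φ 1)).toReal,
          (1 - lowInv φ (upInv Φ (ENNReal.ofReal u) / r)))
        + ∫⁻ u in Set.Ioc (Φ 1).toReal (Φ (r * φ 1)).toReal,
          lowInv φ (upInv Φ (ENNReal.ofReal u) / r)
        = ENNReal.ofReal ((Φ (r * φ 1)).toReal - (Φ 1).toReal) := by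
      rw [← lintegral_add_right _ hmeas,
        setLIntegral_congr_fun (g := fun _ => 1) measurableSet_Ioc
          fun u hu => tsub_add_cancel_of_le (hle u hu)]
      simp
    refine ENNReal.eq_sub_of_add_eq ?_ ?_
    · exact ne_top_of_le_ne_top ENNReal.ofReal_ne_top (hsum ▸ le_add_self)
    · rw [add_assoc, hsum, ENNReal.ofReal_sub _ toReal_nonneg, ENNReal.ofReal_toReal hΦ1,
        ENNReal.ofReal_toReal hΦM]
      exact add_tsub_cancel_of_le (hΦmono.monotoneOn Set.self_mem_Ici hM hM)
end

section
/- Let ε ≥ 0 and β > 0 satisfy β(1+ε) < 1. Then for every random variable T with values in [1,∞], inf_{q∈(0,1]} Q_p(q)/q^{1+ε} ≤ (1 − β(1+ε))^{−1/β} · (E[T^{−β}])^{−1/β}. -/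
open MeasureTheory ENNReal

/-- A lower bound `m` on `Q_p(q) / q ^ s` controls the distribution function of `T`. -/
lemma mul_measure_rpow_le_of_le_iInf_quantile {Ω : Type*} [MeasurableSpace Ω] (μ : Measure Ω)
    [IsProbabilityMeasure μ] (T : Ω → ℝ≥0∞) {s : ℝ} (hs : 0 < s) {m α : ℝ≥0∞}
    (hm : m ≤ ⨅ q ∈ Set.Ioc (0 : ℝ≥0∞) 1, quantile μ T q / q ^ s)
    (hα : 1 ≤ α) (hα' : α ≠ ⊤) : m * μ {ω | T ω ≤ α} ^ s ≤ α := by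
  rcases eq_or_ne (μ {ω | T ω ≤ α}) 0 with h0 | h0
  · simp [h0, ENNReal.zero_rpow_of_pos hs]
  have hq : μ {ω | T ω ≤ α} ∈ Set.Ioc (0 : ℝ≥0∞) 1 := ⟨pos_iff_ne_zero.2 h0, prob_le_one⟩
  have hle : quantile μ T (μ {ω | T ω ≤ α}) ≤ α := sInf_le ⟨hα, hα', le_rfl⟩
  exact ENNReal.mul_le_of_le_div
    ((hm.trans (iInf₂_le _ hq)).trans (ENNReal.div_le_div_right hle _))

/-- Tail integral of a function bounded by `1` and by `(t / A) ^ (-s)`. -/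
lemma setLIntegral_Ioi_le_of_le_one_of_le_rpow {g : ℝ → ℝ≥0∞} {A s : ℝ} (hA : 0 < A) (hs : 1 < s)
    (hg1 : ∀ t, g t ≤ 1) (hg : ∀ t, 0 < t → g t ≤ ENNReal.ofReal (A ^ s * t ^ (-s))) :
    ∫⁻ t in Set.Ioi 0, g t ≤ ENNReal.ofReal (A * s / (s - 1)) := by
  have hs' : 0 < s - 1 := by linarith
  rw [← Set.Ioc_union_Ioi_eq_Ioi hA.le]
  have hhead : ∫⁻ t in Set.Ioc 0 A, g t ≤ ENNReal.ofReal A := by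
    refine (lintegral_mono hg1).trans ?_
    simp
  have htail : ∫⁻ t in Set.Ioi A, g t ≤ ENNReal.ofReal (A / (s - 1)) := by
    calc ∫⁻ t in Set.Ioi A, g t
        ≤ ∫⁻ t in Set.Ioi A, ENNReal.ofReal (A ^ s * t ^ (-s)) :=
          setLIntegral_mono' measurableSet_Ioi fun t ht ↦ hg t (hA.trans ht)
      _ = ENNReal.ofReal (∫ t in Set.Ioi A, A ^ s * t ^ (-s)) := by
          refine (ofReal_integral_eq_lintegral_ofReal
            ((integrableOn_Ioi_rpow_of_lt (by linarith) hA).const_mul _) ?_).symm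
          filter_upwards [ae_restrict_mem measurableSet_Ioi] with t ht
          have : 0 < t := hA.trans ht
          simp only [Pi.zero_apply]
          positivity
      _ = ENNReal.ofReal (A / (s - 1)) := by
          rw [integral_const_mul, integral_Ioi_rpow_of_lt (by linarith) hA, mul_div_assoc',
            mul_neg, ← Real.rpow_add hA, show s + (-s + 1) = 1 by ring, Real.rpow_one,
            show -s + 1 = -(s - 1) by ring, neg_div_neg_eq]
  calc ∫⁻ t in Set.Ioc 0 A ∪ Set.Ioi A, g t
      ≤ _ := lintegral_union_le _ _ _
    _ ≤ ENNReal.ofReal A + ENNReal.ofReal (A / (s - 1)) := add_le_add hhead htail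
    _ = ENNReal.ofReal (A * s / (s - 1)) := by
        rw [← ENNReal.ofReal_add hA.le (by positivity)]
        congr 1
        field_simp
        ring

/-- A power bound on the distribution function of `T` bounds the negative moment `E[T ^ (-β)]`. -/
lemma lintegral_rpow_neg_le_of_mul_measure_rpow_le {Ω : Type*} [MeasurableSpace Ω] (μ : Measure Ω)
    [IsProbabilityMeasure μ] {T : Ω → ℝ≥0∞} (hTmeas : Measurable T) (hT1 : ∀ ω, 1 ≤ T ω)
    {β κ m : ℝ} (hβ : 0 < β) (hκ : 0 < κ) (hβκ : β * κ < 1) (hm : 0 < m)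
    (h : ∀ α : ℝ, 1 ≤ α →
      ENNReal.ofReal m * μ {ω | T ω ≤ ENNReal.ofReal α} ^ κ ≤ ENNReal.ofReal α) :
    ∫⁻ ω, T ω ^ (-β) ∂μ ≤ ENNReal.ofReal (m ^ (-β) / (1 - β * κ)) := by
  have hle1 : ∀ ω, T ω ^ (-β) ≤ 1 := fun ω ↦
    ENNReal.rpow_le_one_of_one_le_of_neg (hT1 ω) (by linarith)
  have hfin : ∀ ω, T ω ^ (-β) ≠ ⊤ := fun ω ↦ ne_top_of_le_ne_top one_ne_top (hle1 ω)
  have hlayer : ∫⁻ ω, T ω ^ (-β) ∂μ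
      = ∫⁻ t in Set.Ioi (0 : ℝ), μ {ω | t ≤ (T ω ^ (-β)).toReal} := by
    rw [← lintegral_eq_lintegral_meas_le μ (.of_forall fun ω ↦ ENNReal.toReal_nonneg)
      (hTmeas.pow_const _).ennreal_toReal.aemeasurable]
    simp [ENNReal.ofReal_toReal (hfin _)]
  have hsub : ∀ t : ℝ, 0 < t → {ω | t ≤ (T ω ^ (-β)).toReal}
      ⊆ {ω | T ω ≤ ENNReal.ofReal (t ^ (-β⁻¹))} := by
    intro t ht ω hω
    have h1 : ENNReal.ofReal t ≤ T ω ^ (-β) := (ENNReal.ofReal_le_iff_le_toReal (hfin ω)).2 hω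
    have h2 : (T ω ^ (-β)) ^ (-β⁻¹) ≤ ENNReal.ofReal t ^ (-β⁻¹) := by
      rw [ENNReal.rpow_neg, ENNReal.rpow_neg _ β⁻¹, ENNReal.inv_le_inv]
      exact ENNReal.rpow_le_rpow h1 (by positivity)
    rwa [← ENNReal.rpow_mul, neg_mul_neg, mul_inv_cancel₀ hβ.ne', ENNReal.rpow_one,
      ENNReal.ofReal_rpow_of_pos ht] at h2
  have hbk : 0 < β * κ := by positivity
  have hbound := setLIntegral_Ioi_le_of_le_one_of_le_rpow
    (g := fun t ↦ μ {ω | t ≤ (T ω ^ (-β)).toReal}) (A := m ^ (-β)) (s := (β * κ)⁻¹)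
    (by positivity) ((one_lt_inv₀ hbk).2 hβκ) (fun _ ↦ prob_le_one) ?_
  · rw [hlayer]
    refine hbound.trans_eq ?_
    congr 1
    have : 1 - β * κ ≠ 0 := by linarith
    have : (β * κ)⁻¹ - 1 = (1 - β * κ) / (β * κ) := by field_simp
    rw [this]
    field_simp
  intro t ht
  rcases le_or_gt t 1 with ht1 | ht1
  · refine (measure_mono (hsub t ht)).trans ?_
    have h3 := h (t ^ (-β⁻¹)) (Real.one_le_rpow_of_pos_of_le_one_of_nonpos ht ht1
      (by simpa using hβ.le))
    set F := μ {ω | T ω ≤ ENNReal.ofReal (t ^ (-β⁻¹))}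
    have h4 : F ^ κ ≤ ENNReal.ofReal (t ^ (-β⁻¹) / m) := by
      rw [ENNReal.ofReal_div_of_pos hm, ENNReal.le_div_iff_mul_le (by simp [hm]) (by simp),
        mul_comm]
      exact h3
    have h5 := ENNReal.rpow_le_rpow h4 (inv_nonneg.2 hκ.le)
    rw [← ENNReal.rpow_mul, mul_inv_cancel₀ hκ.ne', ENNReal.rpow_one,
      ENNReal.ofReal_rpow_of_pos (by positivity)] at h5
    refine h5.trans_eq ?_
    congr 1
    rw [Real.div_rpow (by positivity) hm.le, ← Real.rpow_mul ht.le, ← Real.rpow_mul hm.le,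
      div_eq_mul_inv, ← Real.rpow_neg hm.le, mul_comm]
    congr 2 <;> field_simp
  · have : {ω | t ≤ (T ω ^ (-β)).toReal} = ∅ := by
      refine Set.eq_empty_of_forall_notMem fun ω hω ↦ ?_
      have : (T ω ^ (-β)).toReal ≤ 1 :=
        ENNReal.toReal_le_of_le_ofReal one_pos.le (by simpa using hle1 ω)
      exact absurd (hω.trans this) (not_le.2 ht1)
    simp [this]

/-- For `ε ≥ 0`, `β > 0` with `β(1+ε) < 1`, and every random variable `T` with values
in `[1,∞]`, `inf_{q ∈ (0,1]} Q_p(q)/q^{1+ε} ≤ (1-β(1+ε))^{-1/β} · (E[T^{-β}])^{-1/β}`. -/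
theorem stmt10 (ε β : ℝ) (hε : 0 ≤ ε) (hβ : 0 < β) (hβε : β * (1 + ε) < 1)
    {Ω : Type*} [MeasurableSpace Ω] (μ : Measure Ω) [IsProbabilityMeasure μ]
    (T : Ω → ℝ≥0∞) (hTmeas : Measurable T) (hT1 : ∀ ω, 1 ≤ T ω) :
    (⨅ q ∈ Set.Ioc (0 : ℝ≥0∞) 1, quantile μ T q / q ^ (1 + ε))
      ≤ ENNReal.ofReal ((1 - β * (1 + ε)) ^ (-1 / β))
          * (∫⁻ ω, T ω ^ (-β) ∂μ) ^ (-1 / β) := by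
  have hc : 0 < 1 - β * (1 + ε) := by linarith
  refine ENNReal.le_of_forall_nnreal_lt fun r hr ↦ ?_
  rcases eq_zero_or_pos r with rfl | hr0
  · simp
  have hm : (0 : ℝ) < r := hr0
  have hE := lintegral_rpow_neg_le_of_mul_measure_rpow_le μ hTmeas hT1 hβ
    (by linarith : 0 < 1 + ε) hβε hm fun α hα ↦
      mul_measure_rpow_le_of_le_iInf_quantile μ T (by linarith)
        (by simpa using hr.le) (by simpa using hα) ofReal_ne_top
  have hpow : ENNReal.ofReal ((r : ℝ) ^ (-β) / (1 - β * (1 + ε))) ^ (-1 / β)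
      ≤ (∫⁻ ω, T ω ^ (-β) ∂μ) ^ (-1 / β) := by
    rw [neg_div, ENNReal.rpow_neg, ENNReal.rpow_neg, ENNReal.inv_le_inv]
    exact ENNReal.rpow_le_rpow hE (by positivity)
  refine le_trans (le_of_eq ?_) (mul_le_mul_right hpow _)
  rw [ENNReal.ofReal_rpow_of_pos (by positivity), ← ENNReal.ofReal_mul (by positivity),
    Real.div_rpow (by positivity) hc.le, ← Real.rpow_mul hm.le,
    mul_div_cancel₀ _ (by positivity), show -β * (-1 / β) = 1 by field_simp, Real.rpow_one]
  simp
end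

section
/- Let φ : [1,∞) → (0,∞) be concave, twice differentiable, strictly increasing with φ' > 0, and suppose liminf_{t→∞} t·φ''(t)/φ'(t) > −2. Then there exist ε ∈ (0,1) and C > 0 such that for every random variable T with values in [1,∞], inf_{q∈(0,1]} Q_p(q)/q^{1+ε} ≤ C · φ^{−1}(E[φ(T)]). -/
open MeasureTheory ENNReal Filter

/-- The canonical extension of an increasing `φ : [1,∞) → [0,∞)` to `[1,∞]`
(with values in `[0,∞]`), with `φ(∞) = lim_{t→∞} φ(t)`. -/
noncomputable def phiExt (φ : ℝ → ℝ) (t : ℝ≥0∞) : ℝ≥0∞ :=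
  ⨆ (s : ℝ) (_ : 1 ≤ s) (_ : ENNReal.ofReal s ≤ t), ENNReal.ofReal (φ s)

/-- The inverse of an increasing `φ : [1,∞) → [0,∞)`, extended by
`φ⁻¹(y) = ∞` for `y ≥ sup φ`. -/
noncomputable def phiInvExt (φ : ℝ → ℝ) (y : ℝ≥0∞) : ℝ≥0∞ :=
  sInf {t : ℝ≥0∞ | 1 ≤ t ∧ y ≤ phiExt φ t}

/-- If `liminf t φ''(t)/φ'(t) > -2`, then `t^(2-δ) φ'(t)` is almost increasing for some `δ`. -/
theorem exists_almost_increasing_mul_rpow {φ' φ'' : ℝ → ℝ}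
    (hd2 : ∀ t ∈ Set.Ici (1 : ℝ), HasDerivWithinAt φ' (φ'' t) (Set.Ici 1) t)
    (hd1pos : ∀ t ∈ Set.Ici (1 : ℝ), 0 < φ' t)
    (hliminf : (-2 : EReal)
        < liminf (fun t : ℝ => ((t * φ'' t / φ' t : ℝ) : EReal)) atTop) :
    ∃ δ ∈ Set.Ioo (0 : ℝ) 1, ∃ K : ℝ, 1 ≤ K ∧ ∀ s B : ℝ, 1 ≤ s → s ≤ B →
      φ' s * s ^ (2 - δ) ≤ K * (φ' B * B ^ (2 - δ)) := by
  obtain ⟨c, hc2, hc⟩ := EReal.lt_iff_exists_real_btwn.1 hliminf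
  have hc2' : -2 < c := EReal.coe_lt_coe_iff.1 hc2
  obtain ⟨t₁, ht₁⟩ := eventually_atTop.1 (eventually_lt_of_lt_liminf hc)
  set δ := min (c + 2) (1 / 2) with hδ
  have hδ0 : 0 < δ := lt_min (by linarith) (by norm_num)
  have hδ1 : δ ≤ 1 / 2 := min_le_right _ _
  have hδc : δ ≤ c + 2 := min_le_left _ _
  set t₀ := max t₁ 1
  have ht₀ : 1 ≤ t₀ := le_max_right _ _
  set g : ℝ → ℝ := fun t => φ' t * t ^ (2 - δ) with hg
  have hgcont : ContinuousOn g (Set.Ici 1) := by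
    refine ContinuousOn.mul (fun t ht => (hd2 t ht).continuousWithinAt) ?_
    refine continuousOn_id.rpow_const fun t ht => Or.inl ?_
    have : (1 : ℝ) ≤ t := ht
    simp only [id]
    positivity
  have hgpos : ∀ t, 1 ≤ t → 0 < g t := fun t ht =>
    mul_pos (hd1pos t ht) (Real.rpow_pos_of_pos (by linarith) _)
  have hgmono : MonotoneOn g (Set.Ici t₀) := by
    refine monotoneOn_of_hasDerivWithinAt_nonneg (convex_Ici _)
      (hgcont.mono (Set.Ici_subset_Ici.2 ht₀))
      (f' := fun t => φ'' t * t ^ (2 - δ) + φ' t * ((2 - δ) * t ^ (2 - δ - 1))) ?_ ?_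
    · intro t ht
      rw [interior_Ici] at ht ⊢
      have ht1 : 1 < t := lt_of_le_of_lt ht₀ ht
      refine HasDerivAt.hasDerivWithinAt ?_
      exact ((hd2 t ht1.le).hasDerivAt (Ici_mem_nhds ht1)).mul
        (Real.hasDerivAt_rpow_const (Or.inl (by linarith)))
    · intro t ht
      rw [interior_Ici] at ht
      have ht1 : 1 < t := lt_of_le_of_lt ht₀ ht
      have htt : t₁ ≤ t := (le_max_left _ _).trans (le_of_lt ht)
      have h1 : c < t * φ'' t / φ' t := by exact_mod_cast ht₁ t htt
      have hp := hd1pos t ht1.le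
      rw [lt_div_iff₀ hp] at h1
      have hr : t ^ (2 - δ) = t ^ (2 - δ - 1) * t := by
        rw [← Real.rpow_add_one (by linarith)]; ring_nf
      have hq : 0 < t ^ (2 - δ - 1) := Real.rpow_pos_of_pos (by linarith) _
      have : 0 ≤ t ^ (2 - δ - 1) * (t * φ'' t + (2 - δ) * φ' t) := by
        refine mul_nonneg hq.le ?_
        nlinarith
      rw [hr]
      linarith
  have hne : (Set.Icc 1 t₀).Nonempty := Set.nonempty_Icc.2 ht₀
  have hcI : ContinuousOn g (Set.Icc 1 t₀) := hgcont.mono Set.Icc_subset_Ici_self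
  obtain ⟨m, hm, hmin⟩ := isCompact_Icc.exists_isMinOn hne hcI
  obtain ⟨M, hM, hmax⟩ := isCompact_Icc.exists_isMaxOn hne hcI
  have hgm := hgpos m hm.1
  have hK : 1 ≤ g M / g m := by
    rw [le_div_iff₀ hgm, one_mul]; exact hmax hm
  refine ⟨δ, ⟨hδ0, by linarith⟩, g M / g m, hK, fun s B hs hsB => ?_⟩
  change g s ≤ g M / g m * g B
  have hB : 1 ≤ B := hs.trans hsB
  rcases le_total s t₀ with h | h
  · have h1 : g s ≤ g M := hmax (⟨hs, h⟩ : s ∈ Set.Icc 1 t₀)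
    have h2 : g m ≤ g B := by
      rcases le_total B t₀ with h' | h'
      · exact hmin (⟨hB, h'⟩ : B ∈ Set.Icc 1 t₀)
      · exact (hmin (⟨ht₀, le_rfl⟩ : t₀ ∈ Set.Icc 1 t₀)).trans
          (hgmono (Set.mem_Ici.2 le_rfl) h' h')
    calc g s ≤ g M := h1
      _ = g M / g m * g m := by field_simp
      _ ≤ g M / g m * g B := by gcongr
  · exact (hgmono h (h.trans hsB) hsB).trans
      (le_mul_of_one_le_left (hgpos B hB).le hK)

theorem ofReal_le_phiExt (φ : ℝ → ℝ) {s : ℝ} {t : ℝ≥0∞} (hs : 1 ≤ s)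
    (hst : ENNReal.ofReal s ≤ t) : ENNReal.ofReal (φ s) ≤ phiExt φ t :=
  le_iSup_of_le s (le_iSup_of_le hs (le_iSup_of_le hst le_rfl))

theorem phiExt_ofReal_le {φ : ℝ → ℝ} (hmono : MonotoneOn φ (Set.Ici 1)) {t : ℝ} (ht : 1 ≤ t) :
    phiExt φ (ENNReal.ofReal t) ≤ ENNReal.ofReal (φ t) := by
  refine iSup_le fun s => iSup_le fun hs => iSup_le fun hst => ?_
  exact ENNReal.ofReal_le_ofReal
    (hmono hs ht ((ENNReal.ofReal_le_ofReal_iff (by linarith)).1 hst))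

/-- Lower bounds on quantiles give upper bounds on the cumulative distribution function. -/
theorem measure_Iic_le_of_le_quantileD {p : Measure ℝ≥0∞} [IsProbabilityMeasure p]
    (hp : p (Set.Iio 1) = 0) {a r : ℝ} (ha : 0 < a) (hr : 0 < r)
    (hq : ∀ q ∈ Set.Ioc (0 : ℝ≥0∞) 1, ENNReal.ofReal a * q ^ r ≤ quantileD p q)
    {s : ℝ} (hs : 0 < s) :
    p (Set.Iic (ENNReal.ofReal s)) ≤ ENNReal.ofReal ((s / a) ^ r⁻¹) := by
  rcases eq_or_ne (p (Set.Iic (ENNReal.ofReal s))) 0 with h0 | h0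
  · simp [h0]
  have hs1 : 1 ≤ ENNReal.ofReal s := by
    by_contra! h
    exact h0 (measure_mono_null (fun x hx => lt_of_le_of_lt hx h) hp)
  have h1 := (hq _ ⟨pos_iff_ne_zero.2 h0, prob_le_one⟩).trans
    (sInf_le (⟨hs1, ENNReal.ofReal_ne_top, le_rfl⟩ :
      ENNReal.ofReal s ∈ {α : ℝ≥0∞ | 1 ≤ α ∧ α ≠ ⊤ ∧
        p (Set.Iic (ENNReal.ofReal s)) ≤ p (Set.Iic α)}))
  rw [← ENNReal.ofReal_rpow_of_pos (by positivity), ENNReal.le_rpow_inv_iff hr,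
    ENNReal.ofReal_div_of_pos ha, ENNReal.le_div_iff_mul_le (by simp [ha]) (by simp), mul_comm]
  exact h1

/-- Dyadic comparison: the deficit of `φ(t)` below `φ(B)` is covered by the increments of `φ`
over the dyadic scales `B / 2^k ≥ t`, with a surplus when `t ≥ 2 B`. -/
theorem add_indicator_le_phiExt_add_tsum {φ : ℝ → ℝ} (hmono : MonotoneOn φ (Set.Ici 1))
    (hpos : ∀ t ∈ Set.Ici (1 : ℝ), 0 < φ t) {B : ℝ} (hB : 1 ≤ B) {t : ℝ≥0∞} (ht : 1 ≤ t) :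
    ENNReal.ofReal (φ B) + (Set.Ici (ENNReal.ofReal (2 * B))).indicator
        (fun _ => ENNReal.ofReal (φ (2 * B) - φ B)) t ≤
      phiExt φ t + ∑' k : ℕ, (Set.Iic (ENNReal.ofReal (B / 2 ^ k))).indicator
        (fun _ => ENNReal.ofReal (φ (max 1 (B / 2 ^ k)) - φ (max 1 (B / 2 ^ (k + 1))))) t := by
  have hB0 : 0 < B := by linarith
  rcases le_or_gt (ENNReal.ofReal (2 * B)) t with h2 | h2
  · rw [Set.indicator_of_mem (Set.mem_Ici.2 h2)]
    have hle : φ B ≤ φ (2 * B) :=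
      hmono hB (show (1 : ℝ) ≤ 2 * B by linarith) (by linarith)
    rw [← ENNReal.ofReal_add (hpos B hB).le (by linarith)]
    refine le_add_right ?_
    rw [add_sub_cancel]
    exact ofReal_le_phiExt φ (by linarith) h2
  rw [Set.indicator_of_notMem (by simpa using h2), add_zero]
  rcases le_or_gt (ENNReal.ofReal B) t with h1 | h1
  · exact le_add_right (ofReal_le_phiExt φ hB h1)
  lift t to NNReal using (h1.trans_le le_top).ne
  have ht1 : (1 : ℝ) ≤ t := by exact_mod_cast ht
  have htB : (t : ℝ) < B := by
    rw [← ENNReal.ofReal_coe_nnreal] at h1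
    exact (ENNReal.ofReal_lt_ofReal_iff hB0).1 h1
  obtain ⟨n, hn1, hn2⟩ := exists_nat_pow_near (x := B / t) (y := 2)
    (by rw [one_le_div (by linarith)]; exact htB.le) (by norm_num)
  have hn1' : (t : ℝ) ≤ B / 2 ^ n := by
    rw [le_div_iff₀ (by linarith)] at hn1
    rw [le_div_iff₀ (by positivity)]; linarith
  have hn2' : B / 2 ^ (n + 1) ≤ t := by
    rw [div_lt_iff₀ (by linarith)] at hn2
    rw [div_le_iff₀ (by positivity)]; linarith
  set d : ℕ → ℝ := fun k => φ (max 1 (B / 2 ^ k)) with hd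
  have hanti : ∀ k, d (k + 1) ≤ d k := fun k =>
    hmono (Set.mem_Ici.2 (le_max_left _ _)) (Set.mem_Ici.2 (le_max_left _ _))
      (max_le_max le_rfl (by
        gcongr <;> norm_num))
  have hsum : ENNReal.ofReal (d 0 - d (n + 1)) ≤
      ∑' k : ℕ, (Set.Iic (ENNReal.ofReal (B / 2 ^ k))).indicator
        (fun _ => ENNReal.ofReal (d k - d (k + 1))) (t : ℝ≥0∞) := by
    refine le_trans (le_of_eq ?_) (ENNReal.sum_le_tsum (Finset.range (n + 1)))
    rw [← Finset.sum_range_sub', ENNReal.ofReal_sum_of_nonneg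
      (fun k _ => sub_nonneg.2 (hanti k))]
    refine Finset.sum_congr rfl fun k hk => ?_
    rw [Set.indicator_of_mem]
    rw [Set.mem_Iic, ← ENNReal.ofReal_coe_nnreal]
    refine ENNReal.ofReal_le_ofReal (hn1'.trans ?_)
    have := Finset.mem_range.1 hk
    gcongr
    · norm_num
    · omega
  have hphi : ENNReal.ofReal (d (n + 1)) ≤ phiExt φ t := by
    refine ofReal_le_phiExt φ (le_max_left _ _) ?_
    rw [← ENNReal.ofReal_coe_nnreal]
    exact ENNReal.ofReal_le_ofReal (max_le ht1 hn2')
  refine le_trans ?_ (add_le_add hphi hsum)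
  refine le_trans (le_of_eq ?_) ENNReal.ofReal_add_le
  simp [hd, max_eq_right hB]

/-- The increments of `φ` over dyadic scales below `B`. -/
theorem dyadic_increment_le {φ φ' : ℝ → ℝ} (hconc : ConcaveOn ℝ (Set.Ici 1) φ)
    (hd1 : ∀ t ∈ Set.Ici (1 : ℝ), HasDerivWithinAt φ (φ' t) (Set.Ici 1) t)
    (hd1pos : ∀ t ∈ Set.Ici (1 : ℝ), 0 < φ' t) {δ K : ℝ} (hδ : δ ∈ Set.Ioo (0 : ℝ) 1)
    (hK : 1 ≤ K) (hφ' : ∀ s B : ℝ, 1 ≤ s → s ≤ B →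
      φ' s * s ^ (2 - δ) ≤ K * (φ' B * B ^ (2 - δ))) {B : ℝ} (hB : 1 ≤ B) (k : ℕ) :
    φ (max 1 (B / 2 ^ k)) - φ (max 1 (B / 2 ^ (k + 1))) ≤
      2 * K * (φ' B * B) * ((2 : ℝ) ^ (1 - δ)) ^ k := by
  set x := max 1 (B / 2 ^ (k + 1)) with hx
  set y := max 1 (B / 2 ^ k) with hy
  have hB0 : 0 < B := by linarith
  have hx1 : 1 ≤ x := le_max_left _ _
  have hx0 : 0 < x := by linarith
  have hy1 : 1 ≤ y := le_max_left _ _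
  have hhalf : B / 2 ^ k = 2 * (B / 2 ^ (k + 1)) := by rw [pow_succ]; field_simp
  have hz : 0 < B / 2 ^ (k + 1) := by positivity
  have hzx : B / 2 ^ (k + 1) ≤ x := le_max_right _ _
  have hxB : x ≤ B := max_le hB (div_le_self hB0.le (one_le_pow₀ (by norm_num)))
  have hxy : x ≤ y := max_le_max le_rfl (by linarith)
  have hyx : y - x ≤ B / 2 ^ (k + 1) := by
    rw [sub_le_iff_le_add]
    exact max_le (by linarith) (by linarith)
  have hslope : φ y - φ x ≤ φ' x * (y - x) := by
    rcases hxy.eq_or_lt with h | h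
    · simp [h]
    · have := hconc.slope_le_of_hasDerivWithinAt hx1 hy1 h (hd1 x hx1)
      rwa [slope_def_field, div_le_iff₀ (by linarith)] at this
  have hdx : φ' x ≤ K * φ' B * (2 ^ (k + 1)) ^ (2 - δ) := by
    have h1 := hφ' x B hx1 hxB
    have h2 : B ≤ 2 ^ (k + 1) * x := by
      rw [div_le_iff₀ (by positivity)] at hzx; linarith
    have h3 : B ^ (2 - δ) ≤ (2 ^ (k + 1)) ^ (2 - δ) * x ^ (2 - δ) := by
      rw [← Real.mul_rpow (by positivity) hx0.le]
      exact Real.rpow_le_rpow hB0.le h2 (by linarith [hδ.2])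
    have h4 : 0 < x ^ (2 - δ) := Real.rpow_pos_of_pos hx0 _
    have h5 := hd1pos B hB
    refine le_of_mul_le_mul_right (h1.trans ?_) h4
    calc K * (φ' B * B ^ (2 - δ)) ≤ K * (φ' B * ((2 ^ (k + 1)) ^ (2 - δ) * x ^ (2 - δ))) := by
          gcongr
      _ = _ := by ring
  have h5 := hd1pos B hB
  calc φ y - φ x ≤ φ' x * (y - x) := hslope
    _ ≤ (K * φ' B * (2 ^ (k + 1)) ^ (2 - δ)) * (B / 2 ^ (k + 1)) := by
        gcongr
    _ = K * (φ' B * B) * (2 ^ (k + 1) : ℝ) ^ (1 - δ) := by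
        rw [show (2 : ℝ) - δ = (1 - δ) + 1 by ring, Real.rpow_add_one (by positivity)]
        field_simp
    _ = K * (φ' B * B) * (2 ^ (1 - δ) * ((2 : ℝ) ^ (1 - δ)) ^ k) := by
        rw [← Real.rpow_pow_comm (by norm_num), pow_succ']
    _ ≤ K * (φ' B * B) * (2 ^ (1 : ℝ) * ((2 : ℝ) ^ (1 - δ)) ^ k) := by
        gcongr
        · norm_num
        · linarith [hδ.1]
    _ = _ := by rw [Real.rpow_one]; ring

/-- The gain of `φ` from `B` to `2 B`. -/
theorem le_doubling_increment {φ φ' : ℝ → ℝ} (hconc : ConcaveOn ℝ (Set.Ici 1) φ)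
    (hd1 : ∀ t ∈ Set.Ici (1 : ℝ), HasDerivWithinAt φ (φ' t) (Set.Ici 1) t)
    (hd1pos : ∀ t ∈ Set.Ici (1 : ℝ), 0 < φ' t) {δ K : ℝ} (hδ : δ ∈ Set.Ioo (0 : ℝ) 1)
    (hK : 1 ≤ K) (hφ' : ∀ s B : ℝ, 1 ≤ s → s ≤ B →
      φ' s * s ^ (2 - δ) ≤ K * (φ' B * B ^ (2 - δ))) {B : ℝ} (hB : 1 ≤ B) :
    φ' B * B ≤ 4 * K * (φ (2 * B) - φ B) := by
  have hB0 : 0 < B := by linarith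
  have h2B : 1 ≤ 2 * B := by linarith
  have h1 := hφ' B (2 * B) hB (by linarith)
  have hpos := hd1pos (2 * B) h2B
  have hBp : 0 < B ^ (2 - δ) := Real.rpow_pos_of_pos hB0 _
  have h4 : (2 : ℝ) ^ (2 - δ) ≤ 4 := by
    calc (2 : ℝ) ^ (2 - δ) ≤ 2 ^ (2 : ℝ) :=
          Real.rpow_le_rpow_of_exponent_le (by norm_num) (by linarith [hδ.1])
      _ = 4 := by norm_num
  have h2 : φ' B ≤ 4 * K * φ' (2 * B) := by
    refine le_of_mul_le_mul_right (h1.trans ?_) hBp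
    rw [Real.mul_rpow (by norm_num) hB0.le]
    calc K * (φ' (2 * B) * (2 ^ (2 - δ) * B ^ (2 - δ)))
        ≤ K * (φ' (2 * B) * (4 * B ^ (2 - δ))) := by gcongr
      _ = _ := by ring
  have hslope : φ' (2 * B) * B ≤ φ (2 * B) - φ B := by
    have := hconc.le_slope_of_hasDerivWithinAt hB h2B (by linarith) (hd1 _ h2B)
    rwa [slope_def_field, le_div_iff₀ (by linarith), show 2 * B - B = B by ring] at this
  calc φ' B * B ≤ 4 * K * φ' (2 * B) * B := by gcongr
    _ = 4 * K * (φ' (2 * B) * B) := by ring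
    _ ≤ _ := by gcongr

/-- If `p` has little mass below every dyadic scale `B / 2^k`, then `E[φ(T)] ≥ φ(B)`. -/
theorem ofReal_le_lintegral_phiExt {φ φ' : ℝ → ℝ} (hconc : ConcaveOn ℝ (Set.Ici 1) φ)
    (hmono : MonotoneOn φ (Set.Ici 1)) (hpos : ∀ t ∈ Set.Ici (1 : ℝ), 0 < φ t)
    (hd1 : ∀ t ∈ Set.Ici (1 : ℝ), HasDerivWithinAt φ (φ' t) (Set.Ici 1) t)
    (hd1pos : ∀ t ∈ Set.Ici (1 : ℝ), 0 < φ' t) {δ K : ℝ} (hδ : δ ∈ Set.Ioo (0 : ℝ) 1)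
    (hK : 1 ≤ K) (hφ' : ∀ s B : ℝ, 1 ≤ s → s ≤ B →
      φ' s * s ^ (2 - δ) ≤ K * (φ' B * B ^ (2 - δ))) {B : ℝ} (hB : 1 ≤ B)
    {σ D : ℝ} (hσ : 0 < σ) (hσδ : (2 : ℝ) ^ (1 - δ) * σ < 1)
    (hD : 16 * K ^ 2 ≤ D * (1 - (2 : ℝ) ^ (1 - δ) * σ))
    {p : Measure ℝ≥0∞} [IsProbabilityMeasure p] (hp : p (Set.Iio 1) = 0)
    (hcdf : ∀ k : ℕ, p (Set.Iic (ENNReal.ofReal (B / 2 ^ k))) ≤ ENNReal.ofReal (σ ^ k / D))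
    (hcdf2 : p (Set.Iic (ENNReal.ofReal (2 * B))) ≤ ENNReal.ofReal (1 / 2)) :
    ENNReal.ofReal (φ B) ≤ ∫⁻ t, phiExt φ t ∂p := by
  set ρ : ℝ := (2 : ℝ) ^ (1 - δ) with hρ
  have hρ0 : 0 < ρ := by positivity
  have hX : 0 < φ' B * B := mul_pos (hd1pos B hB) (by linarith)
  have hD0 : 0 < D := by
    by_contra! h
    nlinarith
  set G : ℝ := φ (2 * B) - φ B
  have hG : φ' B * B ≤ 4 * K * G := le_doubling_increment hconc hd1 hd1pos hδ hK hφ' hB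
  have hG0 : 0 < G := pos_of_mul_pos_right (hX.trans_le hG) (by linarith)
  have hgain : ENNReal.ofReal (G / 2) ≤
      ENNReal.ofReal G * p (Set.Ici (ENNReal.ofReal (2 * B))) := by
    have h1 : ENNReal.ofReal (1 / 2) ≤ p (Set.Ici (ENNReal.ofReal (2 * B))) := by
      have h2 : p (Set.Ici (ENNReal.ofReal (2 * B))) = 1 - p (Set.Iio (ENNReal.ofReal (2 * B))) := by
        rw [← Set.compl_Iio, prob_compl_eq_one_sub measurableSet_Iio]
      rw [h2]
      refine le_trans ?_ (tsub_le_tsub_left ((measure_mono Set.Iio_subset_Iic_self).trans hcdf2) 1)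
      rw [← ENNReal.ofReal_one, ← ENNReal.ofReal_sub _ (by norm_num)]
      norm_num
    rw [show G / 2 = G * (1 / 2) by ring, ENNReal.ofReal_mul hG0.le]
    gcongr
  have hloss : ∑' k : ℕ, ENNReal.ofReal (φ (max 1 (B / 2 ^ k)) - φ (max 1 (B / 2 ^ (k + 1)))) *
      p (Set.Iic (ENNReal.ofReal (B / 2 ^ k))) ≤ ENNReal.ofReal (G / 2) := by
    have hgeo := (hasSum_geometric_of_lt_one (mul_pos hρ0 hσ).le hσδ).mul_left
      (2 * K * (φ' B * B) / D)
    calc _ ≤ ∑' k : ℕ, ENNReal.ofReal (2 * K * (φ' B * B) / D * (ρ * σ) ^ k) := by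
          refine ENNReal.tsum_le_tsum fun k => ?_
          refine (mul_le_mul' (ENNReal.ofReal_le_ofReal
            (dyadic_increment_le hconc hd1 hd1pos hδ hK hφ' hB k)) (hcdf k)).trans (le_of_eq ?_)
          rw [← ENNReal.ofReal_mul (by positivity), mul_pow]
          congr 1
          ring
      _ = ENNReal.ofReal (2 * K * (φ' B * B) / D * (1 - ρ * σ)⁻¹) := by
          rw [← hgeo.tsum_eq, ENNReal.ofReal_tsum_of_nonneg (fun k => by positivity) hgeo.summable]
      _ ≤ ENNReal.ofReal (G / 2) := by
          refine ENNReal.ofReal_le_ofReal ?_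
          rw [← div_eq_mul_inv, div_div, div_le_iff₀ (mul_pos hD0 (by linarith))]
          calc 2 * K * (φ' B * B) ≤ 2 * K * (4 * K * G) := by gcongr
            _ = G / 2 * (16 * K ^ 2) := by ring
            _ ≤ _ := by gcongr
  have hae : ∀ᵐ t ∂p, (1 : ℝ≥0∞) ≤ t := by
    rw [ae_iff]
    simp only [not_le]
    exact hp
  have hint := lintegral_mono_ae (hae.mono fun t ht =>
    add_indicator_le_phiExt_add_tsum hmono hpos hB ht)
  rw [lintegral_add_left measurable_const,
    lintegral_add_right _ (Measurable.tsum fun k =>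
      measurable_const.indicator measurableSet_Iic),
    lintegral_tsum fun k => (measurable_const.indicator measurableSet_Iic).aemeasurable] at hint
  simp only [lintegral_indicator_const measurableSet_Iic,
    lintegral_indicator_const measurableSet_Ici, lintegral_const, measure_univ, mul_one] at hint
  refine (ENNReal.add_le_add_iff_right (ENNReal.ofReal_ne_top (r := G / 2))).1 ?_
  calc _ ≤ _ := add_le_add le_rfl hgain
    _ ≤ _ := hint
    _ ≤ _ := add_le_add le_rfl hloss

/-- If `φ : [1,∞) → (0,∞)` is concave, twice differentiable and strictly increasing
with `φ' > 0`, and `liminf_{t→∞} t φ''(t)/φ'(t) > -2`, then there are `ε ∈ (0,1)` and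
`C > 0` such that for every random variable `T` with values in `[1,∞]` (equivalently,
every probability distribution `p` on `[1,∞]`),
`inf_{q ∈ (0,1]} Q_p(q)/q^{1+ε} ≤ C · φ⁻¹(E[φ(T)])`. -/
theorem stmt11 (φ φ' φ'' : ℝ → ℝ)
    (hconc : ConcaveOn ℝ (Set.Ici 1) φ)
    (hmono : StrictMonoOn φ (Set.Ici 1))
    (hpos : ∀ t ∈ Set.Ici (1 : ℝ), 0 < φ t)
    (hd1 : ∀ t ∈ Set.Ici (1 : ℝ), HasDerivWithinAt φ (φ' t) (Set.Ici 1) t)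
    (hd2 : ∀ t ∈ Set.Ici (1 : ℝ), HasDerivWithinAt φ' (φ'' t) (Set.Ici 1) t)
    (hd1pos : ∀ t ∈ Set.Ici (1 : ℝ), 0 < φ' t)
    (hliminf : (-2 : EReal)
        < liminf (fun t : ℝ => ((t * φ'' t / φ' t : ℝ) : EReal)) atTop) :
    ∃ ε ∈ Set.Ioo (0 : ℝ) 1, ∃ C : ℝ, 0 < C ∧
      ∀ (p : Measure ℝ≥0∞), IsProbabilityMeasure p → p (Set.Iio 1) = 0 →
        (⨅ q ∈ Set.Ioc (0 : ℝ≥0∞) 1, quantileD p q / q ^ (1 + ε))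
          ≤ ENNReal.ofReal C * phiInvExt φ (∫⁻ t, phiExt φ t ∂p) := by
  obtain ⟨δ, hδ, K, hK, hφ'⟩ := exists_almost_increasing_mul_rpow hd2 hd1pos hliminf
  have hδ0 := hδ.1
  have hδ1 := hδ.2
  set θ : ℝ := (1 + δ)⁻¹ with hθ
  have hθ0 : 0 < θ := by positivity
  have hθ1 : θ ≤ 1 := inv_le_one_of_one_le₀ (by linarith)
  have hθδ : 1 - δ < θ := by
    rw [hθ, ← one_div, lt_div_iff₀ (by linarith)]
    nlinarith
  set σ : ℝ := (2 : ℝ) ^ (-θ) with hσ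
  have hσ0 : 0 < σ := by positivity
  have hσδ : (2 : ℝ) ^ (1 - δ) * σ < 1 := by
    rw [hσ, ← Real.rpow_add (by norm_num)]
    exact Real.rpow_lt_one_of_one_lt_of_neg (by norm_num) (by linarith)
  set D : ℝ := 16 * K ^ 2 / (1 - (2 : ℝ) ^ (1 - δ) * σ) with hD
  have hgap : 0 < 1 - (2 : ℝ) ^ (1 - δ) * σ := by linarith
  have hD4 : 4 ≤ D := by
    rw [hD, le_div_iff₀ hgap]
    have : 0 < (2 : ℝ) ^ (1 - δ) * σ := by positivity
    nlinarith
  have hDC : (D ^ (1 + δ)) ^ θ = D := by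
    rw [hθ]
    exact Real.rpow_rpow_inv (by linarith) (by linarith)
  have hC0 : 0 < D ^ (1 + δ) := by positivity
  refine ⟨δ, hδ, D ^ (1 + δ), hC0, fun p hprob hp => ?_⟩
  rw [mul_comm, ← ENNReal.div_le_iff_le_mul (Or.inl (by simp [hC0])) (Or.inl (by simp))]
  refine le_sInf fun t ⟨ht1, ht⟩ => ?_
  rw [ENNReal.div_le_iff_le_mul (Or.inl (by simp [hC0])) (Or.inl (by simp))]
  by_contra! hlt
  obtain ⟨a, hta, haA⟩ := ENNReal.lt_iff_exists_nnreal_btwn.1 hlt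
  have htop : t ≠ ⊤ := by
    rintro rfl
    simp [hC0] at hta
  lift t to NNReal using htop
  have ht1' : (1 : ℝ) ≤ t := by exact_mod_cast ht1
  have hta' : (t : ℝ) * D ^ (1 + δ) < a := by
    rw [← ENNReal.ofReal_coe_nnreal, ← ENNReal.ofReal_coe_nnreal,
      ← ENNReal.ofReal_mul (by positivity)] at hta
    exact (ENNReal.ofReal_lt_ofReal_iff_of_nonneg (by positivity)).1 hta
  have ha0 : (0 : ℝ) < a := lt_of_le_of_lt (by positivity) hta'
  set B : ℝ := a / D ^ (1 + δ) with hBdef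
  have htB : (t : ℝ) < B := by rwa [hBdef, lt_div_iff₀ hC0]
  have hB : 1 ≤ B := by linarith
  have hB0 : 0 < B := by linarith
  have hq : ∀ q ∈ Set.Ioc (0 : ℝ≥0∞) 1, ENNReal.ofReal a * q ^ (1 + δ) ≤ quantileD p q := by
    intro q hq
    have h1 := haA.le.trans (iInf₂_le q hq)
    rw [ENNReal.ofReal_coe_nnreal]
    exact ENNReal.mul_le_of_le_div h1
  have hcdf : ∀ c : ℝ, 0 < c →
      p (Set.Iic (ENNReal.ofReal (c * B))) ≤ ENNReal.ofReal (c ^ θ / D) := by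
    intro c hc
    refine (measure_Iic_le_of_le_quantileD hp ha0 (by linarith) hq (mul_pos hc hB0)).trans_eq ?_
    rw [show c * B / a = c / D ^ (1 + δ) by rw [hBdef]; field_simp,
      Real.div_rpow hc.le hC0.le, hDC]
  have hmain := ofReal_le_lintegral_phiExt hconc hmono.monotoneOn hpos hd1 hd1pos hδ hK hφ' hB
    hσ0 hσδ (div_mul_cancel₀ _ hgap.ne').ge hp
    (fun k => by
      have h := hcdf ((2 ^ k)⁻¹) (by positivity)
      rwa [inv_mul_eq_div, Real.inv_rpow (by positivity), ← Real.rpow_neg (by positivity),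
        ← Real.rpow_pow_comm (by norm_num)] at h)
    ((hcdf 2 (by norm_num)).trans (ENNReal.ofReal_le_ofReal (by
      have h2 : (2 : ℝ) ^ θ ≤ 2 := by
        simpa using Real.rpow_le_rpow_of_exponent_le (x := 2) (by norm_num) hθ1
      rw [div_le_iff₀ (by linarith)]
      linarith)))
  rw [← ENNReal.ofReal_coe_nnreal] at ht
  have h := (hmain.trans ht).trans (phiExt_ofReal_le hmono.monotoneOn ht1')
  rw [ENNReal.ofReal_le_ofReal_iff (hpos _ ht1').le] at h
  exact absurd (hmono ht1' hB htB) h.not_gt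
end

section
/- Let ε ∈ (0,1), B ≥ 1, and let g : [B,∞) → (0,∞) be differentiable with g'(t) ≥ −g(t)·( (2−ε)/t + g(t) ) for all t ≥ B. Then for all t ≥ B, g(t) ≥ A·t^{−(2−ε)}, where A = g(B)·B^{2−ε}·exp( −g(B)·B^{2−ε}/(1−ε) ) > 0. -/
/-- If `g > 0` satisfies `g' ≥ -g (p / t + g)` on `[B, ∞)`, then
`1 / (g t * t ^ p) + t ^ (1 - p) / (p - 1)` is nonincreasing there. -/
theorem antitoneOn_inv_mul_rpow_add_rpow {p B : ℝ} (hp : 1 < p) (hB : 0 < B) {g g' : ℝ → ℝ}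
    (hgpos : ∀ t ∈ Set.Ici B, 0 < g t)
    (hderiv : ∀ t ∈ Set.Ici B, HasDerivWithinAt g (g' t) (Set.Ici B) t)
    (hineq : ∀ t ∈ Set.Ici B, -g t * (p / t + g t) ≤ g' t) :
    AntitoneOn (fun t => (g t)⁻¹ * t ^ (-p) + t ^ (1 - p) / (p - 1)) (Set.Ici B) := by
  have hF : ∀ t ∈ Set.Ici B,
      HasDerivWithinAt (fun t => (g t)⁻¹ * t ^ (-p) + t ^ (1 - p) / (p - 1))
        (-g' t / g t ^ 2 * t ^ (-p) + (g t)⁻¹ * (-p * t ^ (-p - 1))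
          + (1 - p) * t ^ (1 - p - 1) / (p - 1)) (Set.Ici B) t := by
    intro t ht
    have ht0 : t ≠ 0 := (hB.trans_le ht).ne'
    exact (((hderiv t ht).fun_inv (hgpos t ht).ne').mul
      (Real.hasDerivAt_rpow_const (Or.inl ht0)).hasDerivWithinAt).add
      ((Real.hasDerivAt_rpow_const (Or.inl ht0)).hasDerivWithinAt.div_const _)
  refine antitoneOn_of_hasDerivWithinAt_nonpos (convex_Ici B)
    (fun t ht => (hF t ht).continuousWithinAt)
    (fun t ht => (hF t (interior_subset ht)).mono interior_subset) fun t ht => ?_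
  have htB := interior_subset ht
  have ht0 : 0 < t := hB.trans_le htB
  have hg := hgpos t htB
  have hp1 : p - 1 ≠ 0 := by linarith
  have hfactor : -g' t / g t ^ 2 * t ^ (-p) + (g t)⁻¹ * (-p * t ^ (-p - 1))
      + (1 - p) * t ^ (1 - p - 1) / (p - 1)
      = -(t ^ (-p) / g t ^ 2 * (g' t - -g t * (p / t + g t))) := by
    rw [Real.rpow_sub_one ht0.ne', show 1 - p - 1 = -p by ring]
    field_simp
    ring
  rw [hfactor, neg_nonpos]
  exact mul_nonneg (by positivity) (sub_nonneg.2 (hineq t htB))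

/-- Let `ε ∈ (0,1)`, `B ≥ 1`, and let `g : [B,∞) → (0,∞)` be differentiable with
`g'(t) ≥ -g(t)((2-ε)/t + g(t))` for all `t ≥ B`. Then for all `t ≥ B`,
`g(t) ≥ A t^{-(2-ε)}` where `A = g(B) B^{2-ε} exp(-g(B) B^{2-ε}/(1-ε)) > 0`. -/
theorem stmt12 (ε B : ℝ) (hε : ε ∈ Set.Ioo (0 : ℝ) 1) (hB : 1 ≤ B)
    (g g' : ℝ → ℝ)
    (hgpos : ∀ t ∈ Set.Ici B, 0 < g t)
    (hderiv : ∀ t ∈ Set.Ici B, HasDerivWithinAt g (g' t) (Set.Ici B) t)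
    (hineq : ∀ t ∈ Set.Ici B, g' t ≥ -g t * ((2 - ε) / t + g t)) :
    ∀ t ∈ Set.Ici B,
      g t ≥ (g B * B ^ (2 - ε) * Real.exp (-(g B * B ^ (2 - ε)) / (1 - ε)))
              * t ^ (-(2 - ε)) := by
  intro t ht
  obtain ⟨-, hε1⟩ := hε
  have hB0 : 0 < B := by linarith
  have ht0 : 0 < t := hB0.trans_le ht
  have hBmem : B ∈ Set.Ici B := Set.self_mem_Ici
  have hanti := antitoneOn_inv_mul_rpow_add_rpow (p := 2 - ε) (by linarith) hB0 hgpos hderiv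
    hineq hBmem ht ht
  have hgB := hgpos B hBmem
  have hgt := hgpos t ht
  have hc : 0 < 1 - ε := by linarith
  simp only [show 2 - ε - 1 = 1 - ε by ring, Real.rpow_neg ht0.le, Real.rpow_neg hB0.le,
    ← mul_inv] at hanti
  have hB1 : B ^ (1 - (2 - ε)) / (1 - ε) ≤ 1 / (1 - ε) := by
    gcongr
    exact Real.rpow_le_one_of_one_le_of_nonpos hB (by linarith)
  have ht1 : 0 ≤ t ^ (1 - (2 - ε)) / (1 - ε) := by positivity
  have htp : 0 < t ^ (2 - ε) := by positivity
  rw [Real.rpow_neg ht0.le, ge_iff_le, ← div_eq_mul_inv, div_le_iff₀ htp, neg_div, Real.exp_neg,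
    ← div_eq_mul_inv]
  set a := g B * B ^ (2 - ε)
  have ha : 0 < a := by positivity
  set b := g t * t ^ (2 - ε)
  have hb : 0 < b := by positivity
  have hinv : b⁻¹ ≤ a⁻¹ + 1 / (1 - ε) := by linarith
  calc a / Real.exp (a / (1 - ε)) ≤ a / (a / (1 - ε) + 1) := by
        gcongr
        exact Real.add_one_le_exp _
    _ = (a⁻¹ + 1 / (1 - ε))⁻¹ := by field_simp; ring
    _ ≤ b := inv_le_of_inv_le₀ hb hinv
end

section
/- Let T be a random variable taking values in [1,∞]. Then for every α ≥ 1, P(T ≤ α) ≤ E[1/T] · E[min{T, α}]. -/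
open MeasureTheory ENNReal

/-- Two-point rearrangement inequality in `ℝ≥0∞`. -/
lemma ENNReal.mul_add_mul_le_of_le {a b c d : ℝ≥0∞} (hab : a ≤ b) (hcd : c ≤ d) :
    a * d + b * c ≤ a * c + b * d := by
  obtain ⟨e, rfl⟩ := exists_add_of_le hab
  obtain ⟨k, rfl⟩ := exists_add_of_le hcd
  calc a * (c + k) + (a + e) * c
      ≤ a * (c + k) + (a + e) * c + e * k := le_self_add
    _ = a * c + (a + e) * (c + k) := by ring

/-- Chebyshev's association inequality for oppositely ordered functions. -/
lemma Antivary.lintegral_mul_le {Ω : Type*} [MeasurableSpace Ω] {μ : Measure Ω}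
    [IsProbabilityMeasure μ] {f g : Ω → ℝ≥0∞} (hf : Measurable f) (hg : Measurable g)
    (hfg : Antivary f g) :
    ∫⁻ ω, f ω * g ω ∂μ ≤ (∫⁻ ω, f ω ∂μ) * ∫⁻ ω, g ω ∂μ := by
  have pointwise (x y : Ω) : f x * g x + f y * g y ≤ f x * g y + f y * g x := by
    rcases lt_trichotomy (g x) (g y) with h | h | h
    · have := ENNReal.mul_add_mul_le_of_le (hfg h) h.le
      rwa [add_comm, add_comm (f x * g y)]
    · rw [h]
    · exact ENNReal.mul_add_mul_le_of_le (hfg h) h.le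
  have inner (x : Ω) : f x * g x + ∫⁻ y, f y * g y ∂μ
      ≤ f x * ∫⁻ y, g y ∂μ + (∫⁻ y, f y ∂μ) * g x := by
    have h := lintegral_mono (μ := μ) (pointwise x)
    rwa [lintegral_add_left measurable_const, lintegral_add_left (hg.const_mul _),
      lintegral_const, measure_univ, mul_one, lintegral_const_mul _ hg,
      lintegral_mul_const _ hf] at h
  have double := lintegral_mono (μ := μ) inner
  rw [lintegral_add_right _ measurable_const, lintegral_add_left (hf.mul_const _),
    lintegral_const, measure_univ, mul_one, lintegral_mul_const _ hf,
    lintegral_const_mul _ hg, ← two_mul, ← two_mul] at double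
  exact (ENNReal.mul_le_mul_iff_right two_ne_zero ofNat_ne_top).1 double

/-- For a random variable `T` with values in `[1,∞]` and every `α ∈ [1,∞)`,
`P(T ≤ α) ≤ E[1/T] · E[min{T,α}]`. -/
theorem stmt13 {Ω : Type*} [MeasurableSpace Ω] (μ : Measure Ω) [IsProbabilityMeasure μ]
    (T : Ω → ℝ≥0∞) (hTmeas : Measurable T) (hT1 : ∀ ω, 1 ≤ T ω)
    (α : ℝ≥0∞) (hα : 1 ≤ α) (hαfin : α ≠ ⊤) :
    μ {ω | T ω ≤ α} ≤ (∫⁻ ω, (T ω)⁻¹ ∂μ) * ∫⁻ ω, min (T ω) α ∂μ := by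
  have antivary : Antivary (fun ω => (T ω)⁻¹) (fun ω => min (T ω) α) := fun x y h =>
    ENNReal.inv_le_inv.2 (le_of_not_ge fun hyx => h.not_ge (min_le_min_right α hyx))
  refine le_trans ?_ (antivary.lintegral_mul_le hTmeas.inv (hTmeas.min measurable_const))
  rw [← lintegral_indicator_one (measurableSet_le hTmeas measurable_const)]
  refine lintegral_mono fun ω => ?_
  by_cases hω : T ω ≤ α
  · simp [hω, ENNReal.inv_mul_cancel (zero_lt_one.trans_le (hT1 ω)).ne'
      (ne_top_of_le_ne_top hαfin hω)]
  · simp [hω]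
end

section
/- Let T be a random variable taking values in [1,∞]. Then 1/E[1/T] ≤ inf_{α≥1} E[min{T,α}]/P(T ≤ α). -/
open MeasureTheory ENNReal

/-- The inequality `2 * m ≤ m ^ 2 / t + t` in `ℝ≥0∞`. -/
lemma ENNReal.two_mul_le_sq_mul_inv_add {m t : ℝ≥0∞} (hm : m ≠ ⊤) (ht : t ≠ 0) :
    2 * m ≤ m ^ 2 * t⁻¹ + t := by
  rcases eq_or_ne t ⊤ with rfl | htop
  · simp
  lift m to NNReal using hm
  lift t to NNReal using htop
  have ht' : t ≠ 0 := by exact_mod_cast ht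
  rw [← ENNReal.coe_inv ht']
  norm_cast
  have hpos : (0 : ℝ) < t := by exact_mod_cast pos_iff_ne_zero.mpr ht'
  rw [← NNReal.coe_le_coe]
  push_cast
  have hsq : (m : ℝ) ^ 2 * (t : ℝ)⁻¹ + t - 2 * m = (m - t) ^ 2 * (t : ℝ)⁻¹ := by
    field_simp
    ring
  have hnonneg : (0 : ℝ) ≤ (m - t) ^ 2 * (t : ℝ)⁻¹ := by positivity
  linarith

/-- For `T ≥ 1` and finite `α ≥ 1`, `P(T ≤ α) ≤ E[min{T,α}] * E[1/T]`. -/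
lemma measure_le_lintegral_min_mul_lintegral_inv {Ω : Type*} [MeasurableSpace Ω] (μ : Measure Ω)
    [IsProbabilityMeasure μ] {T : Ω → ℝ≥0∞} (hTmeas : Measurable T) (hT1 : ∀ ω, 1 ≤ T ω)
    {α : ℝ≥0∞} (hα1 : 1 ≤ α) (hα : α ≠ ⊤) :
    μ {ω | T ω ≤ α} ≤ (∫⁻ ω, min (T ω) α ∂μ) * ∫⁻ ω, (T ω)⁻¹ ∂μ := by
  set m := ∫⁻ ω, min (T ω) α ∂μ with hm
  have hmα : m ≤ α := by
    calc m ≤ ∫⁻ _, α ∂μ := lintegral_mono fun ω => min_le_right _ _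
      _ = α := by simp
  have h1m : 1 ≤ m := by
    calc (1 : ℝ≥0∞) = ∫⁻ _, 1 ∂μ := by simp
      _ ≤ m := lintegral_mono fun ω => le_min (hT1 ω) hα1
  have hmtop : m ≠ ⊤ := ne_top_of_le_ne_top hα hmα
  have hm0 : m ≠ 0 := (zero_lt_one.trans_le h1m).ne'
  have hS : MeasurableSet {ω | T ω ≤ α} := measurableSet_le hTmeas measurable_const
  -- Integrate the pointwise bound `m * (1 + 1_{T ≤ α}) ≤ m² / T + min{T,α}`.
  have hpt : ∀ ω, m + {ω | T ω ≤ α}.indicator (fun _ => m) ω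
      ≤ m ^ 2 * (T ω)⁻¹ + min (T ω) α := by
    intro ω
    by_cases h : T ω ≤ α
    · rw [Set.indicator_of_mem (show ω ∈ {ω | T ω ≤ α} from h), min_eq_left h, ← two_mul]
      exact ENNReal.two_mul_le_sq_mul_inv_add hmtop (zero_lt_one.trans_le (hT1 ω)).ne'
    · rw [Set.indicator_of_notMem (show ω ∉ {ω | T ω ≤ α} from h), min_eq_right (not_le.mp h).le,
        add_zero]
      exact hmα.trans le_add_self
  have hTinv : Measurable fun ω => (T ω)⁻¹ := hTmeas.inv
  have hle := lintegral_mono (μ := μ) hpt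
  rw [lintegral_add_left measurable_const, lintegral_indicator_const hS,
    lintegral_add_left (hTinv.const_mul _), lintegral_const_mul _ hTinv, ← hm,
    lintegral_const, measure_univ, mul_one, add_comm, ENNReal.add_le_add_iff_right hmtop,
    sq, mul_assoc] at hle
  exact (ENNReal.mul_le_mul_iff_right hm0 hmtop).mp hle

/-- For a random variable `T` with values in `[1,∞]`,
`1/E[1/T] ≤ inf_{α ≥ 1} E[min{T,α}] / P(T ≤ α)`. -/
theorem stmt14 {Ω : Type*} [MeasurableSpace Ω] (μ : Measure Ω) [IsProbabilityMeasure μ]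
    (T : Ω → ℝ≥0∞) (hTmeas : Measurable T) (hT1 : ∀ ω, 1 ≤ T ω) :
    (∫⁻ ω, (T ω)⁻¹ ∂μ)⁻¹
      ≤ ⨅ α ∈ Set.Ico (1 : ℝ≥0∞) ⊤, (∫⁻ ω, min (T ω) α ∂μ) / μ {ω | T ω ≤ α} := by
  refine le_iInf₂ fun α hα => ?_
  have hle := measure_le_lintegral_min_mul_lintegral_inv μ hTmeas hT1 hα.1 hα.2.ne
  have hm0 : (∫⁻ ω, min (T ω) α ∂μ) ≠ 0 := by
    refine (zero_lt_one.trans_le ?_).ne'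
    calc (1 : ℝ≥0∞) = ∫⁻ _, 1 ∂μ := by simp
      _ ≤ _ := lintegral_mono fun ω => le_min (hT1 ω) hα.1
  rw [ENNReal.le_div_iff_mul_le (.inr hm0) (.inl (measure_ne_top _ _)), mul_comm]
  exact ENNReal.div_le_of_le_mul hle
end

section
/- Let T be a random variable taking values in [1,∞] with E[1/T] > 0, and write m = 1/E[1/T] ∈ [1,∞). Then inf_{q∈(0,1]} Q_p(q)/q ≤ e² · m · (1 + ln m). -/
open MeasureTheory ENNReal

/-- The infimum of `Q_p(q)/q` controls the distribution function: `inf Q_p(q)/q ≤ α / P(T ≤ α)`. -/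
lemma measure_le_of_le_iInf_quantile_div {Ω : Type*} [MeasurableSpace Ω] (μ : Measure Ω)
    [IsProbabilityMeasure μ] (T : Ω → ℝ≥0∞) {x α : ℝ≥0∞}
    (hx : x ≤ ⨅ q ∈ Set.Ioc (0 : ℝ≥0∞) 1, quantile μ T q / q)
    (h1 : 1 ≤ α) (hα : α ≠ ⊤) (hx0 : x ≠ 0) (hxt : x ≠ ⊤) :
    μ {ω | T ω ≤ α} ≤ α / x := by
  set q := μ {ω | T ω ≤ α}
  rcases eq_or_ne q 0 with h0 | h0
  · simp [h0]
  have hquot : x ≤ quantile μ T q / q :=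
    hx.trans (iInf₂_le q ⟨pos_iff_ne_zero.2 h0, prob_le_one⟩)
  have hquant : quantile μ T q ≤ α := sInf_le ⟨h1, hα, le_rfl⟩
  have hmul : x * q ≤ α :=
    (ENNReal.le_div_iff_mul_le (Or.inl h0) (Or.inl (measure_ne_top _ _))).1
      (hquot.trans (ENNReal.div_le_div_right hquant _))
  rw [ENNReal.le_div_iff_mul_le (Or.inl hx0) (Or.inl hxt), mul_comm]
  exact hmul

/-- A `[0,1]`-valued random variable with tail at most `a / t` has mean at most `a (1 - ln a)`. -/
lemma lintegral_ofReal_le_of_tail_le {Ω : Type*} [MeasurableSpace Ω] (μ : Measure Ω)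
    [IsProbabilityMeasure μ] {f : Ω → ℝ} (hf : Measurable f) (hf0 : ∀ ω, 0 ≤ f ω)
    (hf1 : ∀ ω, f ω ≤ 1) {a : ℝ} (ha : 0 < a) (ha1 : a ≤ 1)
    (htail : ∀ t ∈ Set.Ioc (0 : ℝ) 1, μ {ω | t ≤ f ω} ≤ ENNReal.ofReal (a * t⁻¹)) :
    ∫⁻ ω, ENNReal.ofReal (f ω) ∂μ ≤ ENNReal.ofReal (a * (1 - Real.log a)) := by
  rw [lintegral_eq_lintegral_meas_le μ (ae_of_all _ hf0) hf.aemeasurable]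
  have hsplit : Set.Ioi (0 : ℝ) = Set.Ioc 0 a ∪ (Set.Ioc a 1 ∪ Set.Ioi 1) := by
    rw [Set.Ioc_union_Ioi_eq_Ioi ha1, Set.Ioc_union_Ioi_eq_Ioi ha.le]
  have hlow : ∫⁻ t in Set.Ioc 0 a, μ {ω | t ≤ f ω} ≤ ENNReal.ofReal a :=
    calc ∫⁻ t in Set.Ioc 0 a, μ {ω | t ≤ f ω} ≤ ∫⁻ _ in Set.Ioc 0 a, 1 :=
          lintegral_mono fun _ => prob_le_one
      _ = ENNReal.ofReal a := by simp
  have hint : IntegrableOn (fun t : ℝ => a * t⁻¹) (Set.Ioc a 1) := by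
    refine (ContinuousOn.integrableOn_Icc ?_).mono_set Set.Ioc_subset_Icc_self
    exact continuousOn_const.mul
      (continuousOn_id.inv₀ fun t ht => (ha.trans_le ht.1).ne')
  have hmid : ∫⁻ t in Set.Ioc a 1, μ {ω | t ≤ f ω} ≤ ENNReal.ofReal (a * -Real.log a) :=
    calc ∫⁻ t in Set.Ioc a 1, μ {ω | t ≤ f ω}
        ≤ ∫⁻ t in Set.Ioc a 1, ENNReal.ofReal (a * t⁻¹) :=
          setLIntegral_mono' measurableSet_Ioc fun t ht => htail t ⟨ha.trans ht.1, ht.2⟩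
      _ = ENNReal.ofReal (∫ t in Set.Ioc a 1, a * t⁻¹) := by
          refine (ofReal_integral_eq_lintegral_ofReal hint ?_).symm
          refine (ae_restrict_iff' measurableSet_Ioc).2 (ae_of_all _ fun t ht => ?_)
          exact mul_nonneg ha.le (inv_nonneg.2 (ha.trans ht.1).le)
      _ = ENNReal.ofReal (a * -Real.log a) := by
          rw [← intervalIntegral.integral_of_le ha1, intervalIntegral.integral_const_mul,
            integral_inv_of_pos ha one_pos, one_div, Real.log_inv]
  have hhigh : ∫⁻ t in Set.Ioi 1, μ {ω | t ≤ f ω} = 0 := by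
    refine setLIntegral_eq_zero measurableSet_Ioi fun t ht => ?_
    have hempty : {ω | t ≤ f ω} = ∅ :=
      Set.eq_empty_of_forall_notMem fun ω hω => (lt_of_lt_of_le ht hω).not_ge (hf1 ω)
    simp [hempty]
  rw [hsplit]
  refine (lintegral_union_le _ _ _).trans ?_
  refine (add_le_add hlow ((lintegral_union_le _ _ _).trans
    (add_le_add hmid hhigh.le))).trans ?_
  rw [add_zero, ← ENNReal.ofReal_add ha.le
    (mul_nonneg ha.le (neg_nonneg.2 (Real.log_nonpos ha.le ha1)))]
  exact le_of_eq (by ring_nf)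

/-- The self-referential bound `x ≤ m (1 + ln x)` fails at `x = e² m (1 + ln m)`. -/
lemma mul_one_add_log_lt {m : ℝ} (hm : 1 ≤ m) :
    m * (1 + Real.log (Real.exp 2 * m * (1 + Real.log m)))
      < Real.exp 2 * m * (1 + Real.log m) := by
  have hL : 0 ≤ Real.log m := Real.log_nonneg hm
  have hlog : Real.log (1 + Real.log m) ≤ Real.log m := by
    linarith [Real.log_le_sub_one_of_pos (show 0 < 1 + Real.log m by linarith)]
  have hexp : (3 : ℝ) < Real.exp 2 := by
    linarith [Real.add_one_lt_exp (two_ne_zero (α := ℝ))]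
  rw [Real.log_mul (by positivity) (by positivity), Real.log_mul (by positivity) (by positivity),
    Real.log_exp, mul_comm (Real.exp 2) m, mul_assoc]
  refine mul_lt_mul_of_pos_left ?_ (by linarith)
  nlinarith

/-- For a random variable `T` with values in `[1,∞]` with `E[1/T] > 0` and
`m = 1/E[1/T] ∈ [1,∞)`, `inf_{q ∈ (0,1]} Q_p(q)/q ≤ e² · m · (1 + ln m)`. -/
theorem stmt16 {Ω : Type*} [MeasurableSpace Ω] (μ : Measure Ω) [IsProbabilityMeasure μ]
    (T : Ω → ℝ≥0∞) (hTmeas : Measurable T) (hT1 : ∀ ω, 1 ≤ T ω)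
    (hE : 0 < ∫⁻ ω, (T ω)⁻¹ ∂μ) :
    (⨅ q ∈ Set.Ioc (0 : ℝ≥0∞) 1, quantile μ T q / q)
      ≤ ENNReal.ofReal (Real.exp 2) * (∫⁻ ω, (T ω)⁻¹ ∂μ)⁻¹
          * ENNReal.ofReal (1 + Real.log ((∫⁻ ω, (T ω)⁻¹ ∂μ)⁻¹).toReal) := by
  have hinv1 : ∀ ω, (T ω)⁻¹ ≤ 1 := fun ω => ENNReal.inv_le_one.2 (hT1 ω)
  have hinvt : ∀ ω, (T ω)⁻¹ ≠ ⊤ := fun ω => ((hinv1 ω).trans_lt one_lt_top).ne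
  have hE1 : ∫⁻ ω, (T ω)⁻¹ ∂μ ≤ 1 := (lintegral_mono hinv1).trans (by simp)
  set E := ∫⁻ ω, (T ω)⁻¹ ∂μ
  have hEt : E⁻¹ ≠ ⊤ := ENNReal.inv_ne_top.2 hE.ne'
  set m := (E⁻¹).toReal with hmdef
  have hm : 1 ≤ m := by
    rw [hmdef, ← ENNReal.toReal_one]
    exact ENNReal.toReal_mono hEt (ENNReal.one_le_inv.2 hE1)
  have hm0 : 0 < m := one_pos.trans_le hm
  have hL : 0 ≤ Real.log m := Real.log_nonneg hm
  have hEm : E = ENNReal.ofReal m⁻¹ := by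
    rw [ENNReal.ofReal_inv_of_pos hm0, hmdef, ENNReal.ofReal_toReal hEt, inv_inv]
  set x := Real.exp 2 * m * (1 + Real.log m) with hxdef
  have hx1 : 1 ≤ x := by
    have hexp : 1 ≤ Real.exp 2 := Real.one_le_exp (by norm_num)
    exact one_le_mul_of_one_le_of_one_le (one_le_mul_of_one_le_of_one_le hexp hm) (by linarith)
  have hx0 : 0 < x := one_pos.trans_le hx1
  have hrhs : ENNReal.ofReal (Real.exp 2) * E⁻¹ * ENNReal.ofReal (1 + Real.log m)
      = ENNReal.ofReal x := by
    rw [hxdef, ENNReal.ofReal_mul (by positivity), ENNReal.ofReal_mul (by positivity), hmdef,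
      ENNReal.ofReal_toReal hEt]
  rw [hrhs]
  by_contra! hlt
  have hbound : E ≤ ENNReal.ofReal (x⁻¹ * (1 - Real.log x⁻¹)) := by
    have hreal : E = ∫⁻ ω, ENNReal.ofReal ((T ω)⁻¹).toReal ∂μ :=
      lintegral_congr fun ω => (ENNReal.ofReal_toReal (hinvt ω)).symm
    rw [hreal]
    refine lintegral_ofReal_le_of_tail_le μ hTmeas.inv.ennreal_toReal (fun _ => toReal_nonneg)
      (fun ω => ENNReal.toReal_le_of_le_ofReal zero_le_one (by simpa using hT1 ω))
      (inv_pos.2 hx0) (inv_le_one_of_one_le₀ hx1) fun t ht => ?_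
    have hset : {ω | t ≤ ((T ω)⁻¹).toReal} ⊆ {ω | T ω ≤ ENNReal.ofReal t⁻¹} := fun ω hω => by
      rw [Set.mem_ofPred_eq, ENNReal.ofReal_inv_of_pos ht.1, ENNReal.le_inv_iff_le_inv]
      exact (ENNReal.ofReal_le_iff_le_toReal (hinvt ω)).2 hω
    refine (measure_mono hset).trans ((measure_le_of_le_iInf_quantile_div μ T hlt.le ?_
      ENNReal.ofReal_ne_top (ENNReal.ofReal_pos.2 hx0).ne' ENNReal.ofReal_ne_top).trans ?_)
    · exact ENNReal.one_le_ofReal.2 ((one_le_inv₀ ht.1).2 ht.2)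
    · rw [← ENNReal.ofReal_div_of_pos hx0, div_eq_inv_mul]
  have hlogx : 0 ≤ Real.log x := Real.log_nonneg hx1
  rw [hEm, Real.log_inv, sub_neg_eq_add, ENNReal.ofReal_le_ofReal_iff (by positivity),
    ← div_eq_inv_mul, le_div_iff₀ hx0, inv_mul_le_iff₀ hm0] at hbound
  exact (mul_one_add_log_lt hm).not_ge hbound
end

section
/- Let B ≥ 1 and let φ : [B,∞) → [0,∞) be increasing, twice differentiable, with φ' > 0 and t·φ''(t)/φ'(t) ≤ −2 for all t ≥ B. Then for every random variable X taking values in [B,∞], φ^{−1}(E[φ(X)]) ≤ 1/E[1/X]. -/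
open MeasureTheory ENNReal

/-- The canonical extension of an increasing `φ : [B,∞) → [0,∞)` to `[B,∞]`
(with values in `[0,∞]`), with `φ(∞) = lim_{t→∞} φ(t)`. -/
noncomputable def phiExtFrom (φ : ℝ → ℝ) (B : ℝ) (t : ℝ≥0∞) : ℝ≥0∞ :=
  ⨆ (s : ℝ) (_ : B ≤ s) (_ : ENNReal.ofReal s ≤ t), ENNReal.ofReal (φ s)

/-- The inverse of an increasing `φ : [B,∞) → [0,∞)`, extended by
`φ⁻¹(y) = ∞` for `y ≥ sup φ`. -/
noncomputable def phiInvExtFrom (φ : ℝ → ℝ) (B : ℝ) (y : ℝ≥0∞) : ℝ≥0∞ :=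
  sInf {t : ℝ≥0∞ | ENNReal.ofReal B ≤ t ∧ y ≤ phiExtFrom φ B t}

/-- If `t φ''(t) / φ'(t) ≤ -2` then `t ↦ t² φ'(t)` is nonincreasing. -/
theorem antitoneOn_sq_mul_of_ratio_le {B : ℝ} (hB : 0 < B) {φ' φ'' : ℝ → ℝ}
    (hd : ∀ t ∈ Set.Ici B, HasDerivWithinAt φ' (φ'' t) (Set.Ici B) t)
    (hpos : ∀ t ∈ Set.Ici B, 0 < φ' t)
    (hratio : ∀ t ∈ Set.Ici B, t * φ'' t / φ' t ≤ -2) :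
    AntitoneOn (fun t ↦ t ^ 2 * φ' t) (Set.Ici B) := by
  have hderiv : ∀ t ∈ Set.Ici B, HasDerivWithinAt (fun t ↦ t ^ 2 * φ' t)
      (2 * t * φ' t + t ^ 2 * φ'' t) (Set.Ici B) t := fun t ht ↦ by
    refine ((hasDerivAt_pow 2 t).hasDerivWithinAt.mul (hd t ht)).congr_deriv ?_
    simp
  refine antitoneOn_of_hasDerivWithinAt_nonpos (convex_Ici B)
    (fun t ht ↦ (hderiv t ht).continuousWithinAt)
    (fun t ht ↦ (hderiv t (interior_subset ht)).mono interior_subset) fun t ht ↦ ?_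
  have ht' : t ∈ Set.Ici B := interior_subset ht
  have ht0 : 0 < t := hB.trans_le ht'
  have h := (div_le_iff₀ (hpos t ht')).1 (hratio t ht')
  nlinarith [mul_nonneg ht0.le (sub_nonneg.2 h)]

/-- The tangent-line inequality at `m` for `φ` viewed as a concave function of `-1/t`. -/
theorem add_div_le_of_ratio_le {B : ℝ} (hB : 0 < B) {φ φ' φ'' : ℝ → ℝ}
    (hd1 : ∀ t ∈ Set.Ici B, HasDerivWithinAt φ (φ' t) (Set.Ici B) t)
    (hd2 : ∀ t ∈ Set.Ici B, HasDerivWithinAt φ' (φ'' t) (Set.Ici B) t)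
    (hpos : ∀ t ∈ Set.Ici B, 0 < φ' t)
    (hratio : ∀ t ∈ Set.Ici B, t * φ'' t / φ' t ≤ -2)
    {m s : ℝ} (hm : B ≤ m) (hs : B ≤ s) :
    φ s + m ^ 2 * φ' m * s⁻¹ ≤ φ m + m ^ 2 * φ' m * m⁻¹ := by
  have hanti := antitoneOn_sq_mul_of_ratio_le hB hd2 hpos hratio
  set K := m ^ 2 * φ' m with hK
  have hderiv : ∀ t ∈ Set.Ici B, HasDerivWithinAt (fun t ↦ φ t + K * t⁻¹)
      ((t ^ 2 * φ' t - K) / t ^ 2) (Set.Ici B) t := fun t ht ↦ by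
    have ht0 : t ≠ 0 := (hB.trans_le ht).ne'
    refine ((hd1 t ht).add
      ((hasDerivAt_inv ht0).hasDerivWithinAt.const_mul K)).congr_deriv ?_
    field_simp
    ring
  rcases le_total s m with hsm | hms
  · have hsub : Set.Icc B m ⊆ Set.Ici B := Set.Icc_subset_Ici_self
    refine monotoneOn_of_hasDerivWithinAt_nonneg (convex_Icc B m)
      (fun t ht ↦ (hderiv t (hsub ht)).continuousWithinAt.mono hsub)
      (fun t ht ↦ (hderiv t (hsub (interior_subset ht))).mono (interior_subset.trans hsub))
      (fun t ht ↦ ?_) ⟨hs, hsm⟩ ⟨hm, le_rfl⟩ hsm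
    have ht' := interior_subset ht
    exact div_nonneg (sub_nonneg.2 (hanti ht'.1 hm ht'.2)) (sq_nonneg t)
  · have hsub : Set.Ici m ⊆ Set.Ici B := Set.Ici_subset_Ici.2 hm
    refine antitoneOn_of_hasDerivWithinAt_nonpos (convex_Ici m)
      (fun t ht ↦ (hderiv t (hsub ht)).continuousWithinAt.mono hsub)
      (fun t ht ↦ (hderiv t (hsub (interior_subset ht))).mono (interior_subset.trans hsub))
      (fun t ht ↦ ?_) Set.self_mem_Ici hms hms
    have ht' : m ≤ t := interior_subset ht
    exact div_nonpos_of_nonpos_of_nonneg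
      (sub_nonpos.2 (hanti hm (hm.trans ht') ht')) (sq_nonneg t)

theorem phiExtFrom_mono (φ : ℝ → ℝ) (B : ℝ) : Monotone (phiExtFrom φ B) := fun _ _ h ↦
  iSup_mono fun _ ↦ iSup_mono fun _ ↦ iSup_mono' fun hs ↦ ⟨hs.trans h, le_rfl⟩

theorem ofReal_le_phiExtFrom (φ : ℝ → ℝ) {B s : ℝ} {t : ℝ≥0∞} (hs : B ≤ s)
    (hst : ENNReal.ofReal s ≤ t) : ENNReal.ofReal (φ s) ≤ phiExtFrom φ B t :=
  le_iSup_of_le s (le_iSup_of_le hs (le_iSup_of_le hst le_rfl))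

/-- A bound `φ s + K / s ≤ C` on `[B,∞)` extends to `[B,∞]`. -/
theorem phiExtFrom_add_mul_inv_le {φ : ℝ → ℝ} {B K C : ℝ} (hB : 0 < B) (hK : 0 ≤ K)
    (hnonneg : ∀ t ∈ Set.Ici B, 0 ≤ φ t)
    (hbound : ∀ s, B ≤ s → φ s + K * s⁻¹ ≤ C) {x : ℝ≥0∞} (hx : ENNReal.ofReal B ≤ x) :
    phiExtFrom φ B x + ENNReal.ofReal K * x⁻¹ ≤ ENNReal.ofReal C := by
  have key : ∀ s, B ≤ s → ENNReal.ofReal s ≤ x →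
      ENNReal.ofReal (φ s) + ENNReal.ofReal K * x⁻¹ ≤ ENNReal.ofReal C := fun s hs hsx ↦ by
    have hs0 : 0 < s := hB.trans_le hs
    calc ENNReal.ofReal (φ s) + ENNReal.ofReal K * x⁻¹
        ≤ ENNReal.ofReal (φ s) + ENNReal.ofReal K * (ENNReal.ofReal s)⁻¹ := by gcongr
      _ = ENNReal.ofReal (φ s + K * s⁻¹) := by
        rw [← ENNReal.ofReal_inv_of_pos hs0, ← ENNReal.ofReal_mul hK,
          ← ENNReal.ofReal_add (hnonneg s hs) (by positivity)]
      _ ≤ ENNReal.ofReal C := ENNReal.ofReal_le_ofReal (hbound s hs)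
  have hle : ENNReal.ofReal K * x⁻¹ ≤ ENNReal.ofReal C := le_add_self.trans (key B le_rfl hx)
  refine add_le_of_le_tsub_right_of_le hle (iSup_le fun s ↦ iSup_le fun hs ↦ iSup_le fun hsx ↦ ?_)
  exact ENNReal.le_sub_of_add_le_right (ne_top_of_le_ne_top ofReal_ne_top hle) (key s hs hsx)

/-- Let `B ≥ 1` and `φ : [B,∞) → [0,∞)` be increasing, twice differentiable, with
`φ' > 0` and `t φ''(t)/φ'(t) ≤ -2` on `[B,∞)`. Then for every random variable `X`
with values in `[B,∞]`, `φ⁻¹(E[φ(X)]) ≤ 1/E[1/X]`. -/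
theorem stmt17 (B : ℝ) (hB : 1 ≤ B) (φ φ' φ'' : ℝ → ℝ)
    (hmono : MonotoneOn φ (Set.Ici B))
    (hnonneg : ∀ t ∈ Set.Ici B, 0 ≤ φ t)
    (hd1 : ∀ t ∈ Set.Ici B, HasDerivWithinAt φ (φ' t) (Set.Ici B) t)
    (hd2 : ∀ t ∈ Set.Ici B, HasDerivWithinAt φ' (φ'' t) (Set.Ici B) t)
    (hd1pos : ∀ t ∈ Set.Ici B, 0 < φ' t)
    (hratio : ∀ t ∈ Set.Ici B, t * φ'' t / φ' t ≤ -2)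
    {Ω : Type*} [MeasurableSpace Ω] (μ : Measure Ω) [IsProbabilityMeasure μ]
    (X : Ω → ℝ≥0∞) (hXmeas : Measurable X) (hXB : ∀ ω, ENNReal.ofReal B ≤ X ω) :
    phiInvExtFrom φ B (∫⁻ ω, phiExtFrom φ B (X ω) ∂μ)
      ≤ (∫⁻ ω, (X ω)⁻¹ ∂μ)⁻¹ := by
  have hB0 : 0 < B := one_pos.trans_le hB
  have hBm : ENNReal.ofReal B ≤ (∫⁻ ω, (X ω)⁻¹ ∂μ)⁻¹ := by
    rw [ENNReal.le_inv_iff_le_inv]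
    calc ∫⁻ ω, (X ω)⁻¹ ∂μ ≤ ∫⁻ _, (ENNReal.ofReal B)⁻¹ ∂μ :=
          lintegral_mono fun ω ↦ ENNReal.inv_le_inv.2 (hXB ω)
      _ = (ENNReal.ofReal B)⁻¹ := by simp
  refine sInf_le ⟨hBm, ?_⟩
  generalize hm : (∫⁻ ω, (X ω)⁻¹ ∂μ)⁻¹ = m at hBm ⊢
  rcases eq_or_ne m ∞ with rfl | hmtop
  · calc ∫⁻ ω, phiExtFrom φ B (X ω) ∂μ ≤ ∫⁻ _, phiExtFrom φ B ∞ ∂μ :=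
          lintegral_mono fun ω ↦ phiExtFrom_mono φ B le_top
      _ = phiExtFrom φ B ∞ := by simp
  obtain ⟨r, hr, rfl⟩ : ∃ r, B ≤ r ∧ ENNReal.ofReal r = m :=
    ⟨m.toReal, (ENNReal.ofReal_le_iff_le_toReal hmtop).1 hBm, ENNReal.ofReal_toReal hmtop⟩
  have hr0 : 0 < r := hB0.trans_le hr
  have hK : 0 ≤ r ^ 2 * φ' r := mul_nonneg (sq_nonneg r) (hd1pos r hr).le
  have hinv : ∫⁻ ω, (X ω)⁻¹ ∂μ = ENNReal.ofReal r⁻¹ := by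
    rw [ENNReal.ofReal_inv_of_pos hr0, ← hm, inv_inv]
  have hmeas : Measurable fun ω ↦ (X ω)⁻¹ := hXmeas.inv
  have hint : ∫⁻ ω, phiExtFrom φ B (X ω) ∂μ + ENNReal.ofReal (r ^ 2 * φ' r * r⁻¹)
      ≤ ENNReal.ofReal (φ r) + ENNReal.ofReal (r ^ 2 * φ' r * r⁻¹) :=
    calc ∫⁻ ω, phiExtFrom φ B (X ω) ∂μ + ENNReal.ofReal (r ^ 2 * φ' r * r⁻¹)
        = ∫⁻ ω, phiExtFrom φ B (X ω) + ENNReal.ofReal (r ^ 2 * φ' r) * (X ω)⁻¹ ∂μ := by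
          rw [lintegral_add_right _ (hmeas.const_mul _),
            lintegral_const_mul _ hmeas, hinv, ENNReal.ofReal_mul hK]
      _ ≤ ∫⁻ _, ENNReal.ofReal (φ r + r ^ 2 * φ' r * r⁻¹) ∂μ :=
          lintegral_mono fun ω ↦ phiExtFrom_add_mul_inv_le hB0 hK hnonneg
            (fun s hs ↦ add_div_le_of_ratio_le hB0 hd1 hd2 hd1pos hratio hr hs) (hXB ω)
      _ = ENNReal.ofReal (φ r) + ENNReal.ofReal (r ^ 2 * φ' r * r⁻¹) := by
          rw [lintegral_const, measure_univ, mul_one,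
            ENNReal.ofReal_add (hnonneg r hr) (by positivity)]
  exact (ENNReal.le_of_add_le_add_right ofReal_ne_top hint).trans
    (ofReal_le_phiExtFrom φ hr le_rfl)
end

section
/- Let φ : [1,∞) → [0,∞) be increasing, twice differentiable, with φ' > 0 and limsup_{t→∞} t·φ''(t)/φ'(t) < −2. Then there exists B ≥ 1 such that for every random variable T taking values in [1,∞], φ^{−1}(E[φ(T)]) ≤ (1 + B) / E[1/T]. -/
open MeasureTheory ENNReal Filter

/-- If `t φ''(t) / φ'(t) < -2` beyond `b`, then `t² φ'(t)` is antitone there. -/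
lemma antitoneOn_sq_mul_deriv {φ' φ'' : ℝ → ℝ} {b : ℝ} (hb : 1 ≤ b)
    (hd2 : ∀ t ∈ Set.Ici (1 : ℝ), HasDerivWithinAt φ' (φ'' t) (Set.Ici 1) t)
    (hd1pos : ∀ t ∈ Set.Ici (1 : ℝ), 0 < φ' t)
    (hlt : ∀ t, b ≤ t → t * φ'' t / φ' t < -2) :
    AntitoneOn (fun t => t ^ 2 * φ' t) (Set.Ici b) := by
  refine antitoneOn_of_hasDerivWithinAt_nonpos (convex_Ici b)
    (f' := fun t => 2 * t * φ' t + t ^ 2 * φ'' t) ?_ ?_ ?_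
  · intro t ht
    have h := (hd2 t (hb.trans ht)).continuousWithinAt.mono (Set.Ici_subset_Ici.2 hb)
    exact (continuous_pow 2).continuousWithinAt.mul h
  · intro t ht
    rw [interior_Ici] at ht
    have h := (hd2 t (hb.trans ht.le)).hasDerivAt (Ici_mem_nhds (hb.trans_lt ht))
    exact ((hasDerivAt_pow 2 t).mul h).hasDerivWithinAt.congr_deriv (by simp)
  · intro t ht
    rw [interior_Ici] at ht
    have hp := hd1pos t (hb.trans ht.le)
    have h := hlt t ht.le
    rw [div_lt_iff₀ hp] at h
    have ht0 : 0 < t := by linarith [Set.mem_Ioi.1 ht]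
    nlinarith

/-- If `t² φ'(t)` is antitone then `φ` is concave as a function of `1/t`, so that it lies below its
tangent at `s`. -/
lemma add_div_le_of_antitoneOn {φ φ' : ℝ → ℝ} {b s t : ℝ} (hb : 1 ≤ b)
    (hd1 : ∀ t ∈ Set.Ici (1 : ℝ), HasDerivWithinAt φ (φ' t) (Set.Ici 1) t)
    (hanti : AntitoneOn (fun t => t ^ 2 * φ' t) (Set.Ici b)) (hs : b ≤ s) (ht : b ≤ t) :
    φ t + s ^ 2 * φ' s / t ≤ φ s + s ^ 2 * φ' s / s := by
  set K := s ^ 2 * φ' s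
  have hder : ∀ x, b ≤ x →
      HasDerivWithinAt (fun x => φ x + K / x) (φ' x - K / x ^ 2) (Set.Ici 1) x := by
    intro x hx
    have hx0 : x ≠ 0 := by linarith
    have h := (hd1 x (hb.trans hx)).add
      (((hasDerivAt_inv hx0).const_mul K).hasDerivWithinAt (s := Set.Ici 1))
    exact h.congr_deriv (by ring)
  have hcont : ∀ S ⊆ Set.Ici b, ContinuousOn (fun x => φ x + K / x) S := fun S hS x hx =>
    (hder x (hS hx)).continuousWithinAt.mono (hS.trans (Set.Ici_subset_Ici.2 hb))
  have hderS : ∀ S ⊆ Set.Ici b, ∀ x ∈ S,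
      HasDerivWithinAt (fun x => φ x + K / x) (φ' x - K / x ^ 2) S x := fun S hS x hx =>
    (hder x (hS hx)).mono (hS.trans (Set.Ici_subset_Ici.2 hb))
  have heq : ∀ x, b ≤ x → φ' x - K / x ^ 2 = (x ^ 2 * φ' x - K) / x ^ 2 := by
    intro x hx
    have hx0 : x ≠ 0 := by linarith
    field_simp
  rcases le_total t s with hts | hts
  · have hsub : Set.Icc b s ⊆ Set.Ici b := Set.Icc_subset_Ici_self
    have hm : MonotoneOn (fun x => φ x + K / x) (Set.Icc b s) := by
      refine monotoneOn_of_hasDerivWithinAt_nonneg (convex_Icc b s) (hcont _ hsub)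
        (hderS _ (interior_subset.trans hsub)) fun x hx => ?_
      have hx := interior_subset hx
      rw [heq x hx.1]
      have := hanti hx.1 hs hx.2
      exact div_nonneg (sub_nonneg.2 this) (sq_nonneg x)
    exact hm ⟨ht, hts⟩ ⟨hs, le_rfl⟩ hts
  · have hsub : Set.Ici s ⊆ Set.Ici b := Set.Ici_subset_Ici.2 hs
    have hm : AntitoneOn (fun x => φ x + K / x) (Set.Ici s) := by
      refine antitoneOn_of_hasDerivWithinAt_nonpos (convex_Ici s) (hcont _ hsub)
        (hderS _ (interior_subset.trans hsub)) fun x hx => ?_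
      have hx := interior_subset hx
      rw [heq x (hsub hx)]
      have := hanti hs (hsub hx) hx
      exact div_nonpos_of_nonpos_of_nonneg (sub_nonpos.2 this) (sq_nonneg x)
    exact hm Set.self_mem_Ici hts hts

/-- A bound on `φ r + k / r` for all real `r ≥ 1` passes to the extension `phiExt φ`. -/
lemma phiExt_add_le {φ : ℝ → ℝ} {k C : ℝ} (hk : 0 ≤ k)
    (hnonneg : ∀ t ∈ Set.Ici (1 : ℝ), 0 ≤ φ t)
    (h : ∀ r, 1 ≤ r → φ r + k / r ≤ C) {t : ℝ≥0∞} (ht : 1 ≤ t) :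
    phiExt φ t + ENNReal.ofReal k * t⁻¹ ≤ ENNReal.ofReal C := by
  have key : ∀ r : ℝ, 1 ≤ r → ENNReal.ofReal r ≤ t →
      ENNReal.ofReal (φ r) + ENNReal.ofReal k * t⁻¹ ≤ ENNReal.ofReal C := by
    intro r hr hrt
    have hr0 : 0 < r := by linarith
    calc ENNReal.ofReal (φ r) + ENNReal.ofReal k * t⁻¹
        ≤ ENNReal.ofReal (φ r) + ENNReal.ofReal k * (ENNReal.ofReal r)⁻¹ := by
          gcongr
      _ = ENNReal.ofReal (φ r + k / r) := by
          rw [ENNReal.ofReal_add (hnonneg r hr) (by positivity), ENNReal.ofReal_div_of_pos hr0,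
            div_eq_mul_inv]
      _ ≤ ENNReal.ofReal C := ENNReal.ofReal_le_ofReal (h r hr)
  have hfin : ENNReal.ofReal k * t⁻¹ ≠ ⊤ :=
    ENNReal.mul_ne_top ENNReal.ofReal_ne_top
      (ENNReal.inv_ne_top.2 (zero_lt_one.trans_le ht).ne')
  have hle : ENNReal.ofReal k * t⁻¹ ≤ ENNReal.ofReal C :=
    le_add_self.trans (key 1 le_rfl (by simpa using ht))
  calc phiExt φ t + ENNReal.ofReal k * t⁻¹
      ≤ (ENNReal.ofReal C - ENNReal.ofReal k * t⁻¹) + ENNReal.ofReal k * t⁻¹ := by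
        gcongr
        exact iSup_le fun r => iSup_le fun hr => iSup_le fun hrt =>
          ENNReal.le_sub_of_add_le_right hfin (key r hr hrt)
    _ = ENNReal.ofReal C := tsub_add_cancel_of_le hle

/-- If `φ : [1,∞) → [0,∞)` is increasing, twice differentiable, with `φ' > 0` and
`limsup_{t→∞} t φ''(t)/φ'(t) < -2`, then there exists `B ≥ 1` such that for every
random variable `T` with values in `[1,∞]` (equivalently, every probability
distribution `p` on `[1,∞]`), `φ⁻¹(E[φ(T)]) ≤ (1+B)/E[1/T]`. -/
theorem stmt18 (φ φ' φ'' : ℝ → ℝ)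
    (hmono : MonotoneOn φ (Set.Ici 1))
    (hnonneg : ∀ t ∈ Set.Ici (1 : ℝ), 0 ≤ φ t)
    (hd1 : ∀ t ∈ Set.Ici (1 : ℝ), HasDerivWithinAt φ (φ' t) (Set.Ici 1) t)
    (hd2 : ∀ t ∈ Set.Ici (1 : ℝ), HasDerivWithinAt φ' (φ'' t) (Set.Ici 1) t)
    (hd1pos : ∀ t ∈ Set.Ici (1 : ℝ), 0 < φ' t)
    (hlimsup : limsup (fun t : ℝ => ((t * φ'' t / φ' t : ℝ) : EReal)) atTop
        < (-2 : EReal)) :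
    ∃ B : ℝ, 1 ≤ B ∧
      ∀ (p : Measure ℝ≥0∞), IsProbabilityMeasure p → p (Set.Iio 1) = 0 →
        phiInvExt φ (∫⁻ t, phiExt φ t ∂p)
          ≤ ENNReal.ofReal (1 + B) / ∫⁻ t, t⁻¹ ∂p := by
  obtain ⟨b₀, hb₀⟩ := eventually_atTop.1 (eventually_lt_of_limsup_lt hlimsup)
  obtain ⟨B, hB1, hBb⟩ : ∃ B : ℝ, 1 ≤ B ∧ b₀ ≤ B := ⟨max 1 b₀, le_max_left _ _, le_max_right _ _⟩
  have hanti := antitoneOn_sq_mul_deriv hB1 hd2 hd1pos fun t ht => by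
    have h := hb₀ t (hBb.trans ht)
    have h2 : (-2 : EReal) = ((-2 : ℝ) : EReal) := rfl
    rw [h2] at h
    exact EReal.coe_lt_coe_iff.1 h
  refine ⟨B, hB1, fun p _ hp => ?_⟩
  have hae : ∀ᵐ t ∂p, 1 ≤ t := by
    rw [ae_iff]
    simpa [Set.Iio] using hp
  set E := ∫⁻ t, t⁻¹ ∂p with hE
  have hE1 : E ≤ 1 := by
    calc E ≤ ∫⁻ _, 1 ∂p :=
          lintegral_mono_ae (hae.mono fun t ht => by simpa using ht)
      _ = 1 := by simp
  rcases eq_or_ne E 0 with hE0 | hE0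
  · rw [hE0, ENNReal.div_zero (by simp; linarith)]
    exact le_top
  have hEtop : E ≠ ⊤ := (hE1.trans_lt ENNReal.one_lt_top).ne
  obtain ⟨e, he0, heE⟩ : ∃ e : ℝ, 0 < e ∧ ENNReal.ofReal e = E :=
    ⟨E.toReal, ENNReal.toReal_pos hE0 hEtop, ENNReal.ofReal_toReal hEtop⟩
  have he1 : e ≤ 1 := by rwa [← heE, ENNReal.ofReal_le_one] at hE1
  have hc : 0 < 1 + B := by linarith
  set s := (1 + B) / e with hs
  have hcs : 1 + B ≤ s := by
    rw [hs, le_div_iff₀ he0]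
    nlinarith
  have hs0 : 0 < s := by linarith
  have hs1 : 1 ≤ s := by linarith
  have hKpos : 0 < s ^ 2 * φ' s := mul_pos (by positivity) (hd1pos s hs1)
  set K := s ^ 2 * φ' s
  have hbound : ∀ r, 1 ≤ r → φ r + K / (1 + B) / r ≤ φ s + K / s := by
    intro r hr
    have hrc : r ≤ (1 + B) * r := by nlinarith
    have hcr : B ≤ (1 + B) * r := by nlinarith
    have h1 := add_div_le_of_antitoneOn hB1 hd1 hanti (by linarith : B ≤ s) hcr
    have h2 := hmono (Set.mem_Ici.2 hr) (Set.mem_Ici.2 (hr.trans hrc)) hrc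
    rw [div_div]
    linarith
  have hint : (∫⁻ t, phiExt φ t ∂p) + ENNReal.ofReal (K / s)
      ≤ ENNReal.ofReal (φ s) + ENNReal.ofReal (K / s) := by
    have hKs : ENNReal.ofReal (K / s) = ∫⁻ t, ENNReal.ofReal (K / (1 + B)) * t⁻¹ ∂p := by
      rw [lintegral_const_mul _ measurable_inv, ← hE, ← heE,
        ← ENNReal.ofReal_mul (by positivity)]
      congr 1
      rw [hs]
      field_simp
    rw [← ENNReal.ofReal_add (hnonneg s hs1) (by positivity)]
    nth_rewrite 1 [hKs]
    rw [← lintegral_add_right _ (measurable_inv.const_mul _)]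
    calc _ ≤ ∫⁻ _, ENNReal.ofReal (φ s + K / s) ∂p :=
          lintegral_mono_ae (hae.mono fun t ht =>
            phiExt_add_le (by positivity) hnonneg hbound ht)
      _ = _ := by simp
  have hle : (∫⁻ t, phiExt φ t ∂p) ≤ ENNReal.ofReal (φ s) :=
    (ENNReal.add_le_add_iff_right ENNReal.ofReal_ne_top).1 hint
  rw [← heE, ← ENNReal.ofReal_div_of_pos he0, ← hs]
  refine sInf_le ⟨by simpa using hs1, hle.trans ?_⟩
  exact le_iSup_of_le s (le_iSup_of_le hs1 (le_iSup_of_le le_rfl le_rfl))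
end
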